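/- (Main theorem, C¹ observables) Fix 0 < α < 1. There exist a constant C_α depending only on α and an affine function F : ℝ → ℝ such that for all φ, ψ ∈ C¹(S¹) with ∫ φ dm = ∫ ψ dm, every n > 1, and every sequence β₁, …, β_n ∈ (0, α], one has ∫ |P_{β_n} ∘ ⋯ ∘ P_{β_1} φ − P_{β_n} ∘ ⋯ ∘ P_{β_1} ψ| dm ≤ C_α F(‖φ‖_{C¹} + ‖ψ‖_{C¹}) n^{1 − 1/α} (log n)^{1/α}. -/

import Mathlib

open MeasureTheory Set

/-- The Pomeau–Manneville type map `T_β` on `[0,1]` (identified with the circle `S¹`):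
`T_β x = x + 3^β/2^(1+β) x^(1+β)` for `x ≤ 2/3` and `T_β x = 3x - 2` otherwise. -/
noncomputable def Tmap (β x : ℝ) : ℝ :=
  if x ≤ 2/3 then x + (3:ℝ)^β / 2^(1+β) * x^(1+β) else 3*x - 2

/-- The derivative of `T_β` (left-branch formula at `x ≤ 2/3`). -/
noncomputable def Tderiv (β x : ℝ) : ℝ :=
  if x ≤ 2/3 then 1 + (3:ℝ)^β / 2^(1+β) * (1+β) * x^β else 3

/-- The second derivative of `T_β`. -/
noncomputable def Tderiv2 (β x : ℝ) : ℝ :=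
  if x ≤ 2/3 then (3:ℝ)^β / 2^(1+β) * (1+β) * β * x^(β-1) else 0

/-- The inverse of the left branch of `T_β` (for `x ∈ [0,1]` this is the unique
`y ∈ [0,2/3]` with `T_β y = x`). -/
noncomputable def leftInv (β x : ℝ) : ℝ :=
  sSup {y : ℝ | y ∈ Set.Icc (0:ℝ) (2/3) ∧ Tmap β y ≤ x}

/-- The Perron–Frobenius transfer operator of `T_β` with respect to Lebesgue measure:
`P_β f (x) = ∑_{y ∈ T_β⁻¹ x} f y / T_β' y`; the right branch preimage of `x` is `(x+2)/3`,
where the derivative is `3`. -/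
noncomputable def Pop (β : ℝ) (f : ℝ → ℝ) (x : ℝ) : ℝ :=
  f (leftInv β x) / Tderiv β (leftInv β x) + f ((x+2)/3) / 3

/-- `P_{β_{k+n}} ∘ ⋯ ∘ P_{β_{k+1}}`. -/
noncomputable def PopCompFrom (β : ℕ → ℝ) (k : ℕ) : ℕ → (ℝ → ℝ) → ℝ → ℝ
  | 0, f => f
  | n+1, f => Pop (β (k+n+1)) (PopCompFrom β k n f)

/-- `P_{β_n} ∘ ⋯ ∘ P_{β_1}`. -/
noncomputable def PopComp (β : ℕ → ℝ) (n : ℕ) : (ℝ → ℝ) → ℝ → ℝ :=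
  PopCompFrom β 0 n

/-- `T_{β_{k+n}} ∘ ⋯ ∘ T_{β_{k+1}}`. -/
noncomputable def TcompFrom (β : ℕ → ℝ) (k : ℕ) : ℕ → ℝ → ℝ
  | 0, x => x
  | n+1, x => Tmap (β (k+n+1)) (TcompFrom β k n x)

/-- The derivative `(T_{β_{k+n}} ∘ ⋯ ∘ T_{β_{k+1}})'(z)`, computed as the product of the
derivatives along the orbit of `z`. -/
noncomputable def DcompFrom (β : ℕ → ℝ) (k n : ℕ) (z : ℝ) : ℝ :=
  ∏ i ∈ Finset.range n, Tderiv (β (k+i+1)) (TcompFrom β k i z)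

/-- The averaging operator `A_ε f (x) = (1/(2ε)) ∫_{B_ε(x)} f dm` on the circle,
realized via the 1-periodic extension of `f`. -/
noncomputable def Aop (ε : ℝ) (f : ℝ → ℝ) (x : ℝ) : ℝ :=
  (1/(2*ε)) * ∫ t in (x-ε)..(x+ε), f (Int.fract t)

/-- The indicator function of the ball `B_ε(z)` of radius `ε` around `z` in the circle `ℝ/ℤ`. -/
noncomputable def ballInd (ε z : ℝ) : ℝ → ℝ :=
  Set.indicator {y : ℝ | ∃ k : ℤ, |y - z - (k:ℝ)| < ε} (fun _ => 1)

/-- The cone `C₁ = {f ∈ C⁰((0,1]) : f ≥ 0, f decreasing, x ↦ x^(α+1) f x increasing}`. -/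
def memC1 (α : ℝ) (f : ℝ → ℝ) : Prop :=
  ContinuousOn f (Set.Ioc 0 1) ∧ (∀ x ∈ Set.Ioc (0:ℝ) 1, 0 ≤ f x) ∧
  AntitoneOn f (Set.Ioc 0 1) ∧ MonotoneOn (fun x : ℝ => x^(α+1) * f x) (Set.Ioc 0 1)

/-- `m(f) = ∫₀¹ f dm` (Lebesgue). -/
noncomputable def mInt (f : ℝ → ℝ) : ℝ := ∫ x in Set.Ioc (0:ℝ) 1, f x

/-- The cone `C₂ = {f ∈ C₁ ∩ L¹(m) : f x ≤ a x^(-α) m(f)}`. -/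
def memC2 (α a : ℝ) (f : ℝ → ℝ) : Prop :=
  memC1 α f ∧ IntegrableOn f (Set.Ioc 0 1) volume ∧
  ∀ x ∈ Set.Ioc (0:ℝ) 1, f x ≤ a * x^(-α) * mInt f

/-- The `L¹(m)` norm on `[0,1]`. -/
noncomputable def L1norm (f : ℝ → ℝ) : ℝ := ∫ x in Set.Ioc (0:ℝ) 1, |f x|

/-- The `C¹` norm `‖f‖_∞ + ‖f'‖_∞` on the circle. -/
noncomputable def C1norm (f : ℝ → ℝ) : ℝ :=
  (⨆ x : Set.Icc (0:ℝ) 1, |f (x:ℝ)|) + ⨆ x : Set.Icc (0:ℝ) 1, |deriv f (x:ℝ)|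

lemma three_div_two_rpow_mul {β y : ℝ} (hy : 0 ≤ y) :
    (3:ℝ)^β / 2^(1+β) * y^β = 1/2 * (3/2*y)^β := by
  rw [Real.rpow_add (by norm_num), Real.rpow_one, Real.mul_rpow (by norm_num) hy,
    Real.div_rpow (by norm_num) (by norm_num)]
  have : (2:ℝ)^β ≠ 0 := by positivity
  field_simp

/-- The relative increment `T_β y / y - 1` of the left branch. -/
noncomputable def relIncr (β y : ℝ) : ℝ := 1/2 * (3/2*y)^β

lemma relIncr_nonneg {β y : ℝ} (hy : 0 ≤ y) : 0 ≤ relIncr β y := by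
  unfold relIncr; positivity

lemma relIncr_le_half {β y : ℝ} (hβ : 0 < β) (hy : y ∈ Icc (0:ℝ) (2/3)) :
    relIncr β y ≤ 1/2 := by
  have : (3/2*y)^β ≤ 1 := Real.rpow_le_one (by linarith [hy.1]) (by linarith [hy.2]) hβ.le
  unfold relIncr; linarith

lemma relIncr_mono {β x y : ℝ} (hβ : 0 < β) (hx : 0 ≤ x) (hxy : x ≤ y) :
    relIncr β x ≤ relIncr β y := by
  have : (3/2*x)^β ≤ (3/2*y)^β := Real.rpow_le_rpow (by linarith) (by linarith) hβ.le
  unfold relIncr; linarith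

lemma Tmap_left {β y : ℝ} (hβ : 0 < β) (hy : y ∈ Icc (0:ℝ) (2/3)) :
    Tmap β y = y * (1 + relIncr β y) := by
  have h : y^(1+β) = y * y^β := by
    rw [Real.rpow_add_of_nonneg hy.1 zero_le_one hβ.le, Real.rpow_one]
  have := three_div_two_rpow_mul (β := β) hy.1
  rw [Tmap, if_pos hy.2, h, relIncr, ← this]
  ring

lemma Tderiv_left {β y : ℝ} (hy : y ∈ Icc (0:ℝ) (2/3)) :
    Tderiv β y = 1 + (1 + β) * relIncr β y := by
  have := three_div_two_rpow_mul (β := β) hy.1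
  rw [Tderiv, if_pos hy.2, relIncr, ← this]
  ring

lemma one_le_Tderiv_left {β y : ℝ} (hβ : 0 < β) (hy : y ∈ Icc (0:ℝ) (2/3)) :
    1 ≤ Tderiv β y := by
  rw [Tderiv_left hy]
  have := relIncr_nonneg (β := β) hy.1
  nlinarith

lemma Tmap_strictMonoOn {β : ℝ} (hβ : 0 < β) : StrictMonoOn (Tmap β) (Icc (0:ℝ) (2/3)) := by
  intro x hx y hy hxy
  rw [Tmap_left hβ hx, Tmap_left hβ hy]
  have h1 := relIncr_mono hβ hx.1 hxy.le
  have h2 := relIncr_nonneg (β := β) hx.1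
  have := hx.1
  nlinarith

lemma Tmap_zero {β : ℝ} (hβ : 0 < β) : Tmap β 0 = 0 := by
  rw [Tmap_left hβ ⟨le_rfl, by norm_num⟩, zero_mul]

lemma Tmap_two_thirds {β : ℝ} (hβ : 0 < β) : Tmap β (2/3) = 1 := by
  rw [Tmap_left hβ ⟨by norm_num, le_rfl⟩, relIncr]
  norm_num

lemma Tmap_hasDerivAt_left {β y : ℝ} (hy : y ∈ Ioc (0:ℝ) (2/3)) :
    HasDerivWithinAt (Tmap β) (Tderiv β y) (Iic (2/3)) y := by
  have h1 : HasDerivAt (fun x : ℝ => x + (3:ℝ)^β / 2^(1+β) * x^(1+β))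
      (1 + (3:ℝ)^β / 2^(1+β) * ((1+β) * y^(1+β-1))) y :=
    (hasDerivAt_id y).add ((Real.hasDerivAt_rpow_const (Or.inl hy.1.ne')).const_mul _)
  have h2 : Tderiv β y = 1 + (3:ℝ)^β / 2^(1+β) * ((1+β) * y^(1+β-1)) := by
    rw [Tderiv, if_pos hy.2, add_sub_cancel_left]; ring
  rw [h2]
  refine h1.hasDerivWithinAt.congr (fun x hx => ?_) ?_
  · exact if_pos hx
  · exact if_pos hy.2

lemma Tmap_continuousOn {β : ℝ} (hβ : 0 < β) : ContinuousOn (Tmap β) (Icc (0:ℝ) (2/3)) := by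
  have h : ContinuousOn (fun x : ℝ => x + (3:ℝ)^β / 2^(1+β) * x^(1+β)) (Icc (0:ℝ) (2/3)) :=
    continuousOn_id.add (continuousOn_const.mul
      (continuousOn_id.rpow_const fun _ _ => Or.inr (by linarith)))
  exact h.congr fun x hx => if_pos hx.2

lemma leftInv_Tmap {β y : ℝ} (hβ : 0 < β) (hy : y ∈ Icc (0:ℝ) (2/3)) :
    leftInv β (Tmap β y) = y := by
  have : {z : ℝ | z ∈ Set.Icc (0:ℝ) (2/3) ∧ Tmap β z ≤ Tmap β y} = Icc 0 y := by
    ext z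
    constructor
    · rintro ⟨hz, h⟩
      exact ⟨hz.1, ((Tmap_strictMonoOn hβ).le_iff_le hz hy).1 h⟩
    · rintro ⟨h0, h⟩
      have hz : z ∈ Icc (0:ℝ) (2/3) := ⟨h0, h.trans hy.2⟩
      exact ⟨hz, ((Tmap_strictMonoOn hβ).le_iff_le hz hy).2 h⟩
  rw [leftInv, this, csSup_Icc hy.1]

lemma exists_Tmap_eq {β x : ℝ} (hβ : 0 < β) (hx : x ∈ Icc (0:ℝ) 1) :
    ∃ y ∈ Icc (0:ℝ) (2/3), Tmap β y = x := by
  have := intermediate_value_Icc (by norm_num : (0:ℝ) ≤ 2/3) (Tmap_continuousOn hβ)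
  rw [Tmap_zero hβ, Tmap_two_thirds hβ] at this
  exact this hx

lemma leftInv_mem_Icc {β x : ℝ} (hβ : 0 < β) (hx : x ∈ Icc (0:ℝ) 1) :
    leftInv β x ∈ Icc (0:ℝ) (2/3) := by
  obtain ⟨y, hy, rfl⟩ := exists_Tmap_eq hβ hx
  rwa [leftInv_Tmap hβ hy]

lemma Tmap_leftInv {β x : ℝ} (hβ : 0 < β) (hx : x ∈ Icc (0:ℝ) 1) :
    Tmap β (leftInv β x) = x := by
  obtain ⟨y, hy, rfl⟩ := exists_Tmap_eq hβ hx
  rw [leftInv_Tmap hβ hy]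

lemma leftInv_strictMonoOn {β : ℝ} (hβ : 0 < β) : StrictMonoOn (leftInv β) (Icc (0:ℝ) 1) := by
  intro x hx y hy hxy
  rw [← (Tmap_strictMonoOn hβ).lt_iff_lt (leftInv_mem_Icc hβ hx) (leftInv_mem_Icc hβ hy),
    Tmap_leftInv hβ hx, Tmap_leftInv hβ hy]
  exact hxy

lemma leftInv_zero {β : ℝ} (hβ : 0 < β) : leftInv β 0 = 0 := by
  conv_lhs => rw [← Tmap_zero hβ]
  exact leftInv_Tmap hβ ⟨le_rfl, by norm_num⟩

lemma leftInv_one {β : ℝ} (hβ : 0 < β) : leftInv β 1 = 2/3 := by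
  conv_lhs => rw [← Tmap_two_thirds hβ]
  exact leftInv_Tmap hβ ⟨by norm_num, le_rfl⟩

lemma leftInv_mem_Ioc {β x : ℝ} (hβ : 0 < β) (hx : x ∈ Ioc (0:ℝ) 1) :
    leftInv β x ∈ Ioc (0:ℝ) (2/3) := by
  refine ⟨?_, (leftInv_mem_Icc hβ (Ioc_subset_Icc_self hx)).2⟩
  have := leftInv_strictMonoOn hβ ⟨le_rfl, zero_le_one⟩ (Ioc_subset_Icc_self hx) hx.1
  rwa [leftInv_zero hβ] at this

lemma leftInv_mem_unit {β x : ℝ} (hβ : 0 < β) (hx : x ∈ Ioc (0:ℝ) 1) :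
    leftInv β x ∈ Ioc (0:ℝ) 1 :=
  ⟨(leftInv_mem_Ioc hβ hx).1, (leftInv_mem_Ioc hβ hx).2.trans (by norm_num)⟩

lemma leftInv_sub_le {β p q : ℝ} (hβ : 0 < β) (hp : 0 ≤ p) (hpq : p ≤ q) (hq : q ≤ 1) :
    leftInv β q - leftInv β p ≤ leftInv β (q - p) := by
  have hp' : p ∈ Icc (0:ℝ) 1 := ⟨hp, hpq.trans hq⟩
  have hq' : q ∈ Icc (0:ℝ) 1 := ⟨hp.trans hpq, hq⟩
  have hqp : q - p ∈ Icc (0:ℝ) 1 := ⟨by linarith, by linarith⟩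
  have ha := leftInv_mem_Icc hβ hp'
  have hb := leftInv_mem_Icc hβ hq'
  have hTa := Tmap_leftInv hβ hp'
  have hTb := Tmap_leftInv hβ hq'
  have hab := (leftInv_strictMonoOn hβ).monotoneOn hp' hq' hpq
  set a := leftInv β p
  set b := leftInv β q
  have hba : b - a ∈ Icc (0:ℝ) (2/3) := ⟨by linarith, by linarith [ha.1, hb.2]⟩
  rw [← (Tmap_strictMonoOn hβ).le_iff_le hba (leftInv_mem_Icc hβ hqp), Tmap_leftInv hβ hqp,
    ← hTa, ← hTb, Tmap_left hβ ha, Tmap_left hβ hb, Tmap_left hβ hba]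
  have h1 := relIncr_mono hβ ha.1 hab
  have h2 := relIncr_mono hβ hba.1 (by linarith [ha.1] : b - a ≤ b)
  nlinarith [ha.1, hba.1]

lemma two_thirds_mul_le_leftInv {β x : ℝ} (hβ : 0 < β) (hx : x ∈ Icc (0:ℝ) 1) :
    2/3 * x ≤ leftInv β x := by
  have h : 2/3 * x ∈ Icc (0:ℝ) (2/3) := ⟨by linarith [hx.1], by linarith [hx.2]⟩
  rw [← (Tmap_strictMonoOn hβ).le_iff_le h (leftInv_mem_Icc hβ hx), Tmap_leftInv hβ hx,
    Tmap_left hβ h]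
  have := relIncr_le_half hβ h
  nlinarith [hx.1]

lemma relIncr_antitone_exponent {α β y : ℝ} (hβα : β ≤ α) (hy : y ∈ Ioc (0:ℝ) (2/3)) :
    1/2 * (3/2*y)^α ≤ relIncr β y := by
  have : (3/2*y)^α ≤ (3/2*y)^β :=
    Real.rpow_le_rpow_of_exponent_ge (by linarith [hy.1]) (by linarith [hy.2]) hβα
  unfold relIncr; linarith

lemma half_rpow_le_relIncr {α β y : ℝ} (hα : 0 < α) (hβα : β ≤ α) (hy : y ∈ Ioc (0:ℝ) (2/3)) :
    1/2 * y^α ≤ relIncr β y := by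
  have h : y^α ≤ (3/2*y)^α := Real.rpow_le_rpow hy.1.le (by linarith [hy.1]) hα.le
  linarith [relIncr_antitone_exponent hβα hy]

/-- Each backward step along the neutral branch increases `x ^ (-α)` by a definite amount. -/
lemma rpow_neg_add_le_leftInv {α β x : ℝ} (hα : 0 < α) (hα1 : α < 1) (hβ : β ∈ Ioc (0:ℝ) α)
    (hx : x ∈ Ioc (0:ℝ) 1) : x^(-α) + α/3 ≤ (leftInv β x)^(-α) := by
  have hy := leftInv_mem_Ioc hβ.1 hx
  have hT := Tmap_leftInv hβ.1 (Ioc_subset_Icc_self hx)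
  set y := leftInv β x
  rw [Tmap_left hβ.1 (Ioc_subset_Icc_self hy)] at hT
  have hs0 := relIncr_nonneg (β := β) hy.1.le
  have hs1 := relIncr_le_half hβ.1 (Ioc_subset_Icc_self hy)
  have hs2 := half_rpow_le_relIncr hα hβ.2 hy
  set s := relIncr β y
  have hB : (1 + s)^(-α) ≤ 1 - α * (2/3*s) := by
    have e : (1 + s)^(-α) = (1 + (-(s/(1+s))))^α := by
      rw [Real.rpow_neg (by linarith), ← Real.inv_rpow (by linarith)]
      congr 1
      field_simp
      ring
    have h1 : 2/3*s ≤ s/(1+s) := by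
      rw [le_div_iff₀ (by linarith)]; nlinarith
    have h2 : s/(1+s) ≤ 1 := by
      rw [div_le_one (by linarith)]; linarith
    rw [e]
    refine (rpow_one_add_le_one_add_mul_self (by linarith) hα.le hα1.le).trans ?_
    nlinarith
  have hyp : 0 < y^(-α) := Real.rpow_pos_of_pos hy.1 _
  have hx' : x^(-α) = y^(-α) * (1+s)^(-α) := by
    rw [← hT, Real.mul_rpow hy.1.le (by linarith)]
  have hprod : y^(-α) * y^α = 1 := by
    rw [← Real.rpow_add hy.1]; simp
  rw [hx']
  nlinarith [mul_le_mul_of_nonneg_left hB hyp.le, mul_le_mul_of_nonneg_left hs2 hyp.le,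
    mul_le_mul_of_nonneg_left (mul_le_mul_of_nonneg_left hs2 hyp.le) hα.le]

/-- The contribution of the left branch to the transfer operator. -/
noncomputable def leftOp (β : ℝ) (f : ℝ → ℝ) (x : ℝ) : ℝ :=
  f (leftInv β x) / Tderiv β (leftInv β x)

/-- The contribution of the right branch to the transfer operator. -/
noncomputable def rightOp (f : ℝ → ℝ) (x : ℝ) : ℝ := f ((x+2)/3) / 3

lemma Pop_eq (β : ℝ) (f : ℝ → ℝ) : Pop β f = fun x => leftOp β f x + rightOp f x := rfl

lemma right_mem_Ioc {x : ℝ} (hx : x ∈ Ioc (0:ℝ) 1) : (x+2)/3 ∈ Ioc (2/3:ℝ) 1 :=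
  ⟨by linarith [hx.1], by linarith [hx.2]⟩

lemma right_mem_unit {x : ℝ} (hx : x ∈ Ioc (0:ℝ) 1) : (x+2)/3 ∈ Ioc (0:ℝ) 1 :=
  ⟨by linarith [hx.1], by linarith [hx.2]⟩

lemma image_Tmap_Ioc {β b : ℝ} (hβ : 0 < β) (hb : b ∈ Icc (0:ℝ) 1) :
    Tmap β '' Ioc 0 (leftInv β b) = Ioc 0 b := by
  have hb' := leftInv_mem_Icc hβ hb
  ext x
  constructor
  · rintro ⟨y, hy, rfl⟩
    have hy' : y ∈ Icc (0:ℝ) (2/3) := ⟨hy.1.le, hy.2.trans hb'.2⟩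
    have h0 := Tmap_strictMonoOn hβ ⟨le_rfl, by norm_num⟩ hy' hy.1
    have h1 := (Tmap_strictMonoOn hβ).monotoneOn hy' hb' hy.2
    rw [Tmap_zero hβ] at h0
    rw [Tmap_leftInv hβ hb] at h1
    exact ⟨h0, h1⟩
  · intro hx
    have hx' : x ∈ Ioc (0:ℝ) 1 := ⟨hx.1, hx.2.trans hb.2⟩
    exact ⟨leftInv β x, ⟨(leftInv_mem_Ioc hβ hx').1,
      (leftInv_strictMonoOn hβ).monotoneOn (Ioc_subset_Icc_self hx') hb hx.2⟩,
      Tmap_leftInv hβ (Ioc_subset_Icc_self hx')⟩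

lemma Tderiv_smul_leftOp {β y : ℝ} (hβ : 0 < β) (hy : y ∈ Icc (0:ℝ) (2/3)) (f : ℝ → ℝ) :
    |Tderiv β y| • leftOp β f (Tmap β y) = f y := by
  have := one_le_Tderiv_left hβ hy
  rw [leftOp, leftInv_Tmap hβ hy, abs_of_pos (by linarith), smul_eq_mul]
  field_simp

lemma integral_leftOp {β b : ℝ} (hβ : 0 < β) (hb : b ∈ Icc (0:ℝ) 1) (f : ℝ → ℝ) :
    ∫ x in Ioc 0 b, leftOp β f x = ∫ x in Ioc 0 (leftInv β b), f x := by
  have hb' := leftInv_mem_Icc hβ hb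
  have hsub : Ioc 0 (leftInv β b) ⊆ Icc (0:ℝ) (2/3) := fun y hy => ⟨hy.1.le, hy.2.trans hb'.2⟩
  rw [← image_Tmap_Ioc hβ hb, integral_image_eq_integral_abs_deriv_smul measurableSet_Ioc
    (f' := Tderiv β) (fun y hy => (Tmap_hasDerivAt_left ⟨hy.1, hy.2.trans hb'.2⟩).mono
      fun z hz => (hsub hz).2) ((Tmap_strictMonoOn hβ).injOn.mono hsub)]
  exact setIntegral_congr_fun measurableSet_Ioc fun y hy => Tderiv_smul_leftOp hβ (hsub hy) f

lemma integrableOn_leftOp {β : ℝ} (hβ : 0 < β) {f : ℝ → ℝ} (hf : IntegrableOn f (Ioc 0 1)) :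
    IntegrableOn (leftOp β f) (Ioc 0 1) := by
  have h1 : (1:ℝ) ∈ Icc (0:ℝ) 1 := ⟨zero_le_one, le_rfl⟩
  have hb' := leftInv_mem_Icc hβ h1
  have hsub : Ioc 0 (leftInv β 1) ⊆ Icc (0:ℝ) (2/3) := fun y hy => ⟨hy.1.le, hy.2.trans hb'.2⟩
  rw [← image_Tmap_Ioc hβ h1, integrableOn_image_iff_integrableOn_abs_deriv_smul measurableSet_Ioc
    (f' := Tderiv β) (fun y hy => (Tmap_hasDerivAt_left ⟨hy.1, hy.2.trans hb'.2⟩).mono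
      fun z hz => (hsub hz).2) ((Tmap_strictMonoOn hβ).injOn.mono hsub)]
  refine (hf.mono_set (Ioc_subset_Ioc_right (hb'.2.trans (by norm_num)))).congr_fun ?_
    measurableSet_Ioc
  exact fun y hy => (Tderiv_smul_leftOp hβ (hsub hy) f).symm

lemma image_right_Ioc : (fun y : ℝ => 3*y - 2) '' Ioc (2/3) 1 = Ioc 0 1 := by
  ext x
  constructor
  · rintro ⟨y, hy, rfl⟩
    exact ⟨by linarith [hy.1], by linarith [hy.2]⟩
  · exact fun hx => ⟨(x+2)/3, right_mem_Ioc hx, by ring⟩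

lemma hasDerivAt_right (y : ℝ) : HasDerivAt (fun y : ℝ => 3*y - 2) 3 y := by
  simpa using ((hasDerivAt_id y).const_mul 3).sub_const 2

lemma smul_rightOp (f : ℝ → ℝ) (y : ℝ) : |(3:ℝ)| • rightOp f (3*y - 2) = f y := by
  rw [rightOp, abs_of_pos (by norm_num), smul_eq_mul,
    show (3*y - 2 + 2)/3 = y by ring]
  field_simp

lemma integral_rightOp (f : ℝ → ℝ) :
    ∫ x in Ioc 0 1, rightOp f x = ∫ x in Ioc (2/3) 1, f x := by
  rw [← image_right_Ioc, integral_image_eq_integral_abs_deriv_smul measurableSet_Ioc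
    (f' := fun _ => 3) (fun y _ => (hasDerivAt_right y).hasDerivWithinAt)
    (fun x _ y _ h => by simpa using h)]
  exact setIntegral_congr_fun measurableSet_Ioc fun y _ => smul_rightOp f y

lemma integrableOn_rightOp {f : ℝ → ℝ} (hf : IntegrableOn f (Ioc 0 1)) :
    IntegrableOn (rightOp f) (Ioc 0 1) := by
  rw [← image_right_Ioc, integrableOn_image_iff_integrableOn_abs_deriv_smul measurableSet_Ioc
    (f' := fun _ => 3) (fun y _ => (hasDerivAt_right y).hasDerivWithinAt)
    (fun x _ y _ h => by simpa using h)]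
  refine (hf.mono_set (Ioc_subset_Ioc_left (by norm_num))).congr_fun ?_ measurableSet_Ioc
  exact fun y _ => (smul_rightOp f y).symm

lemma integrableOn_Pop {β : ℝ} (hβ : 0 < β) {f : ℝ → ℝ} (hf : IntegrableOn f (Ioc 0 1)) :
    IntegrableOn (Pop β f) (Ioc 0 1) :=
  (integrableOn_leftOp hβ hf).add (integrableOn_rightOp hf)

lemma mInt_leftOp_add_rightOp {β : ℝ} (hβ : 0 < β) {f : ℝ → ℝ} (hf : IntegrableOn f (Ioc 0 1)) :
    mInt (leftOp β f) + mInt (rightOp f) = mInt f := by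
  rw [mInt, mInt, integral_leftOp hβ ⟨zero_le_one, le_rfl⟩, integral_rightOp, leftInv_one hβ,
    ← setIntegral_union (Ioc_disjoint_Ioc_of_le le_rfl) measurableSet_Ioc
      (hf.mono_set (Ioc_subset_Ioc_right (by norm_num)))
      (hf.mono_set (Ioc_subset_Ioc_left (by norm_num))),
    Ioc_union_Ioc_eq_Ioc (by norm_num) (by norm_num), mInt]

lemma mInt_Pop {β : ℝ} (hβ : 0 < β) {f : ℝ → ℝ} (hf : IntegrableOn f (Ioc 0 1)) :
    mInt (Pop β f) = mInt f := by
  rw [← mInt_leftOp_add_rightOp hβ hf]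
  exact integral_add (integrableOn_leftOp hβ hf) (integrableOn_rightOp hf)

lemma Tderiv_leftInv_ge {β x : ℝ} (hβ : 0 < β) (hx : x ∈ Ioc (0:ℝ) 1) :
    1 ≤ Tderiv β (leftInv β x) :=
  one_le_Tderiv_left hβ (leftInv_mem_Icc hβ (Ioc_subset_Icc_self hx))

lemma Pop_le_Pop {β : ℝ} (hβ : 0 < β) {f g : ℝ → ℝ} (h : ∀ x ∈ Ioc (0:ℝ) 1, f x ≤ g x) :
    ∀ x ∈ Ioc (0:ℝ) 1, Pop β f x ≤ Pop β g x := by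
  intro x hx
  have h0 := Tderiv_leftInv_ge hβ hx
  have h1 := h _ (leftInv_mem_unit hβ hx)
  have h2 := h _ (right_mem_unit hx)
  unfold Pop
  gcongr

lemma L1norm_Pop_le {β : ℝ} (hβ : 0 < β) {f : ℝ → ℝ} (hf : IntegrableOn f (Ioc 0 1)) :
    L1norm (Pop β f) ≤ L1norm f := by
  have h : L1norm f = mInt (Pop β fun x => |f x|) := (mInt_Pop hβ hf.abs).symm
  rw [h]
  refine setIntegral_mono_on (integrableOn_Pop hβ hf).abs (integrableOn_Pop hβ hf.abs)
    measurableSet_Ioc fun x hx => ?_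
  have h0 := Tderiv_leftInv_ge hβ hx
  refine (abs_add_le _ _).trans_eq ?_
  rw [abs_div, abs_div, abs_of_pos (by linarith : 0 < Tderiv β (leftInv β x)),
    abs_of_pos (by norm_num : (0:ℝ) < 3)]
  rfl

/-- The cone of nonnegative decreasing functions `u` on `(0,1]` such that `x ^ (α + 1) * u x` is
increasing. -/
structure IsCone (α : ℝ) (u : ℝ → ℝ) : Prop where
  nonneg : ∀ x ∈ Ioc (0:ℝ) 1, 0 ≤ u x
  anti : AntitoneOn u (Ioc 0 1)
  mono : MonotoneOn (fun x : ℝ => x^(α+1) * u x) (Ioc 0 1)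

namespace IsCone

variable {α β : ℝ} {u v : ℝ → ℝ}

lemma congr (hu : IsCone α u) (h : EqOn u v (Ioc 0 1)) : IsCone α v where
  nonneg x hx := h hx ▸ hu.nonneg x hx
  anti := hu.anti.congr h
  mono := hu.mono.congr fun x hx => by simp only [h hx]

lemma zero : IsCone α (fun _ => 0) where
  nonneg _ _ := le_rfl
  anti _ _ _ _ _ := le_rfl
  mono _ _ _ _ _ := by simp

lemma one (hα : 0 < α) : IsCone α (fun _ => 1) where
  nonneg _ _ := zero_le_one
  anti _ _ _ _ _ := le_rfl
  mono x hx y _ hxy := by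
    simpa using Real.rpow_le_rpow hx.1.le hxy (by linarith)

lemma add (hu : IsCone α u) (hv : IsCone α v) : IsCone α (fun x => u x + v x) where
  nonneg x hx := add_nonneg (hu.nonneg x hx) (hv.nonneg x hx)
  anti := hu.anti.add hv.anti
  mono := (hu.mono.add hv.mono).congr fun x _ => by simp only [mul_add]

lemma const_mul (hu : IsCone α u) {c : ℝ} (hc : 0 ≤ c) : IsCone α (fun x => c * u x) where
  nonneg x hx := mul_nonneg hc (hu.nonneg x hx)
  anti x hx y hy hxy := mul_le_mul_of_nonneg_left (hu.anti hx hy hxy) hc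
  mono x hx y hy hxy := by
    have := mul_le_mul_of_nonneg_left (hu.mono hx hy hxy) hc
    dsimp only at this ⊢
    linarith

lemma sum {ι : Type*} (s : Finset ι) {U : ι → ℝ → ℝ} (h : ∀ i ∈ s, IsCone α (U i)) :
    IsCone α (fun x => ∑ i ∈ s, U i x) := by
  classical
  induction s using Finset.induction_on with
  | empty => simpa using zero
  | insert i s hi ih =>
    simp only [Finset.sum_insert hi]
    exact (h i (Finset.mem_insert_self i s)).add
      (ih fun j hj => h j (Finset.mem_insert_of_mem hj))

lemma rightOp (hα : 0 < α) (hu : IsCone α u) : IsCone α (rightOp u) where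
  nonneg x hx := div_nonneg (hu.nonneg _ (right_mem_unit hx)) (by norm_num)
  anti x hx y hy hxy := by
    have := hu.anti (right_mem_unit hx) (right_mem_unit hy) (by linarith)
    unfold _root_.rightOp
    gcongr
  mono x hx y hy hxy := by
    have h := hu.mono (right_mem_unit hx) (right_mem_unit hy) (by linarith)
    have hzx := right_mem_unit hx
    have hzy := right_mem_unit hy
    have key : ∀ t ∈ Ioc (0:ℝ) 1, t^(α+1) * _root_.rightOp u t
        = (t / ((t+2)/3))^(α+1) / 3 * (((t+2)/3)^(α+1) * u ((t+2)/3)) := by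
      intro t ht
      have h1 : 0 < ((t+2)/3)^(α+1) := Real.rpow_pos_of_pos (right_mem_unit ht).1 _
      rw [Real.div_rpow ht.1.le (right_mem_unit ht).1.le, _root_.rightOp]
      field_simp
    dsimp only at h ⊢
    rw [key x hx, key y hy]
    have hr : x / ((x+2)/3) ≤ y / ((y+2)/3) := by
      rw [div_le_div_iff₀ hzx.1 hzy.1]; linarith
    have hr' : (x / ((x+2)/3))^(α+1) ≤ (y / ((y+2)/3))^(α+1) :=
      Real.rpow_le_rpow (div_nonneg hx.1.le hzx.1.le) hr (by linarith)
    have h3 : 0 ≤ ((x+2)/3)^(α+1) * u ((x+2)/3) :=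
      mul_nonneg (Real.rpow_nonneg hzx.1.le _) (hu.nonneg _ hzx)
    have h4 : 0 ≤ (y / ((y+2)/3))^(α+1) :=
      Real.rpow_nonneg (div_nonneg hy.1.le hzy.1.le) _
    gcongr

end IsCone

lemma rpow_div_mono {α β s t : ℝ} (hα : 0 < α) (hβ : β ∈ Ioc (0:ℝ) α) (hs : 0 ≤ s) (hst : s ≤ t) :
    (1+s)^(α+1) / (1+(1+β)*s) ≤ (1+t)^(α+1) / (1+(1+β)*t) := by
  have hβ0 := hβ.1
  have hs1 : 0 < 1 + (1+β)*s := by nlinarith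
  have ht1 : 0 < 1 + (1+β)*t := by nlinarith
  have hq : 0 ≤ (t-s)/(1+s) := div_nonneg (by linarith) (by linarith)
  have e : 1 + t = (1+s) * (1 + (t-s)/(1+s)) := by
    have : (1+s) ≠ 0 := by linarith
    field_simp
    ring
  have hB := one_add_mul_self_le_rpow_one_add (s := (t-s)/(1+s)) (p := α+1) (by linarith)
    (by linarith)
  have h2 : 1 + (1+β)*t ≤ (1 + (α+1)*((t-s)/(1+s))) * (1+(1+β)*s) := by
    have h3 : (1+β)*(1+s) ≤ (α+1)*(1+(1+β)*s) := by
      nlinarith [hβ.2, mul_nonneg hα.le hs, mul_nonneg (mul_nonneg hα.le hs) hβ0.le,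
        mul_nonneg hs hβ0.le]
    have h4 := mul_le_mul_of_nonneg_left h3 hq
    have h5 : (t-s)/(1+s) * (1+s) = t - s := by
      have : (1+s) ≠ 0 := by linarith
      field_simp
    nlinarith
  rw [div_le_div_iff₀ hs1 ht1, e, Real.mul_rpow (by linarith) (by linarith), mul_assoc]
  gcongr
  exact h2.trans (mul_le_mul_of_nonneg_right hB hs1.le)

lemma IsCone.leftOp {α β : ℝ} {u : ℝ → ℝ} (hα : 0 < α) (hβ : β ∈ Ioc (0:ℝ) α)
    (hu : IsCone α u) : IsCone α (leftOp β u) where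
  nonneg x hx := div_nonneg (hu.nonneg _ (leftInv_mem_unit hβ.1 hx))
    (by linarith [Tderiv_leftInv_ge hβ.1 hx])
  anti x hx y hy hxy := by
    have hxy' := (leftInv_strictMonoOn hβ.1).monotoneOn (Ioc_subset_Icc_self hx)
      (Ioc_subset_Icc_self hy) hxy
    have h := hu.anti (leftInv_mem_unit hβ.1 hx) (leftInv_mem_unit hβ.1 hy) hxy'
    have h1 := Tderiv_leftInv_ge hβ.1 hx
    have h2 : Tderiv β (leftInv β x) ≤ Tderiv β (leftInv β y) := by
      rw [Tderiv_left (Ioc_subset_Icc_self (leftInv_mem_Ioc hβ.1 hx)),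
        Tderiv_left (Ioc_subset_Icc_self (leftInv_mem_Ioc hβ.1 hy))]
      have := relIncr_mono hβ.1 (leftInv_mem_Ioc hβ.1 hx).1.le hxy'
      nlinarith [hβ.1]
    have h0 := hu.nonneg _ (leftInv_mem_unit hβ.1 hx)
    unfold _root_.leftOp
    gcongr
  mono x hx y hy hxy := by
    have hxy' := (leftInv_strictMonoOn hβ.1).monotoneOn (Ioc_subset_Icc_self hx)
      (Ioc_subset_Icc_self hy) hxy
    have h := hu.mono (leftInv_mem_unit hβ.1 hx) (leftInv_mem_unit hβ.1 hy) hxy'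
    have hzx := leftInv_mem_Ioc hβ.1 hx
    have hs := relIncr_mono hβ.1 hzx.1.le hxy'
    have hs0 := relIncr_nonneg (β := β) hzx.1.le
    have key : ∀ t ∈ Ioc (0:ℝ) 1, t^(α+1) * _root_.leftOp β u t
        = (1 + relIncr β (leftInv β t))^(α+1) / (1 + (1+β) * relIncr β (leftInv β t))
          * ((leftInv β t)^(α+1) * u (leftInv β t)) := by
      intro t ht
      have hz := Ioc_subset_Icc_self (leftInv_mem_Ioc hβ.1 ht)
      have hT := Tmap_leftInv hβ.1 (Ioc_subset_Icc_self ht)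
      have hr := relIncr_nonneg (β := β) hz.1
      rw [Tmap_left hβ.1 hz] at hT
      rw [_root_.leftOp, Tderiv_left hz]
      have hp : t^(α+1) = (leftInv β t)^(α+1) * (1 + relIncr β (leftInv β t))^(α+1) := by
        rw [← Real.mul_rpow hz.1 (by linarith), hT]
      rw [hp]
      ring
    dsimp only at h ⊢
    rw [key x hx, key y hy]
    have hr := rpow_div_mono hα hβ hs0 hs
    have h3 : 0 ≤ (leftInv β x)^(α+1) * u (leftInv β x) :=
      mul_nonneg (Real.rpow_nonneg hzx.1.le _) (hu.nonneg _ (leftInv_mem_unit hβ.1 hx))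
    have h4 : 0 ≤ (1 + relIncr β (leftInv β y))^(α+1) / (1 + (1+β) * relIncr β (leftInv β y)) :=
      div_nonneg (Real.rpow_nonneg (by linarith) _) (by nlinarith [hβ.1])
    exact mul_le_mul hr h h3 h4

lemma IsCone.Pop {α β : ℝ} {u : ℝ → ℝ} (hα : 0 < α) (hβ : β ∈ Ioc (0:ℝ) α)
    (hu : IsCone α u) : IsCone α (Pop β u) :=
  (hu.leftOp hα hβ).add (hu.rightOp hα)

lemma mInt_nonneg {f : ℝ → ℝ} (h : ∀ x ∈ Ioc (0:ℝ) 1, 0 ≤ f x) : 0 ≤ mInt f :=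
  setIntegral_nonneg measurableSet_Ioc h

lemma IsCone.mul_le_mInt {α z : ℝ} {f : ℝ → ℝ} (hf : IsCone α f)
    (hi : IntegrableOn f (Ioc 0 1)) (hz : z ∈ Ioc (0:ℝ) 1) : z * f z ≤ mInt f := by
  have hsub : Ioc 0 z ⊆ Ioc (0:ℝ) 1 := Ioc_subset_Ioc_right hz.2
  calc z * f z = ∫ _ in Ioc 0 z, f z := by
        rw [setIntegral_const]; simp [hz.1.le]
    _ ≤ ∫ x in Ioc 0 z, f x :=
        setIntegral_mono_on (by simp) (hi.mono_set hsub) measurableSet_Ioc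
          fun x hx => hf.anti (hsub hx) hz hx.2
    _ ≤ mInt f := setIntegral_mono_set hi
        ((ae_restrict_mem measurableSet_Ioc).mono fun x hx => hf.nonneg x hx)
        hsub.eventuallyLE

/-- Integrable functions in the cone, dominated by a fixed multiple of their mean times
`x ^ (-α)`. -/
structure IsTame (α : ℝ) (f : ℝ → ℝ) : Prop where
  cone : IsCone α f
  integrable : IntegrableOn f (Ioc 0 1)
  le : ∀ x ∈ Ioc (0:ℝ) 1, f x ≤ 3/(1-α) * x^(-α) * mInt f

lemma IsTame.one {α : ℝ} (hα : 0 < α) (hα1 : α < 1) : IsTame α (fun _ => 1) where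
  cone := .one hα
  integrable := by simp
  le x hx := by
    have h1 : (1:ℝ) ≤ x^(-α) := Real.one_le_rpow_of_pos_of_le_one_of_nonpos hx.1 hx.2 (by linarith)
    have h2 : 1 ≤ 3/(1-α) := by rw [le_div_iff₀ (by linarith)]; linarith
    have : mInt (fun _ => 1) = 1 := by simp [mInt]
    rw [this]
    nlinarith

lemma IsTame.Pop {α β : ℝ} {f : ℝ → ℝ} (hα : 0 < α) (hα1 : α < 1) (hβ : β ∈ Ioc (0:ℝ) α)
    (hf : IsTame α f) : IsTame α (Pop β f) where
  cone := hf.cone.Pop hα hβ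
  integrable := integrableOn_Pop hβ.1 hf.integrable
  le x hx := by
    have hM := mInt_nonneg hf.cone.nonneg
    have hz := right_mem_Ioc hx
    have hR : f ((x+2)/3) / 3 ≤ mInt f / 2 := by
      have := hf.cone.mul_le_mInt hf.integrable (right_mem_unit hx)
      have := hf.cone.nonneg _ (right_mem_unit hx)
      nlinarith [hz.1]
    rw [mInt_Pop hβ.1 hf.integrable, _root_.Pop]
    have hL := hf.le _ (leftInv_mem_unit hβ.1 hx)
    have hy := leftInv_mem_Ioc hβ.1 hx
    have hT := Tmap_leftInv hβ.1 (Ioc_subset_Icc_self hx)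
    rw [Tmap_left hβ.1 (Ioc_subset_Icc_self hy)] at hT
    rw [Tderiv_left (Ioc_subset_Icc_self hy)]
    have hs0 := relIncr_nonneg (β := β) hy.1.le
    have hs1 := relIncr_le_half hβ.1 (Ioc_subset_Icc_self hy)
    have hs2 := half_rpow_le_relIncr hα hβ.2 hy
    set y := leftInv β x
    set s := relIncr β y
    set M := mInt f
    have hYW : y^(-α) * y^α = 1 := by rw [← Real.rpow_add hy.1]; simp
    have hY : 0 < y^(-α) := Real.rpow_pos_of_pos hy.1 _
    have hx' : x^(-α) = y^(-α) * (1+s)^(-α) := by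
      rw [← hT, Real.mul_rpow hy.1.le (by linarith)]
    have hαs : 0 ≤ α * s := mul_nonneg hα.le hs0
    have hβ0 := hβ.1
    have hβs : 0 ≤ β * s := mul_nonneg hβ0.le hs0
    have hR2 : 1 / (1 + α*s) ≤ (1+s)^(-α) := by
      rw [Real.rpow_neg (by linarith), one_div]
      exact inv_anti₀ (Real.rpow_pos_of_pos (by linarith) _)
        (rpow_one_add_le_one_add_mul_self (by linarith) hα.le hα1.le)
    have hK : 0 < 3/(1-α) := div_pos (by norm_num) (by linarith)
    have hgap : 1/(1+(1+β)*s) + (1-α)*s/3 ≤ 1/(1+α*s) := by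
      rw [← sub_nonneg]
      have : 1/(1+α*s) - (1/(1+(1+β)*s) + (1-α)*s/3)
          = s * (3 * (1+β-α) - (1-α) * ((1+α*s) * (1+(1+β)*s)))
            / (3 * ((1+α*s) * (1+(1+β)*s))) := by
        have : 1+α*s ≠ 0 := by linarith
        have : 1+(1+β)*s ≠ 0 := by nlinarith
        field_simp
        ring
      rw [this]
      refine div_nonneg (mul_nonneg hs0 ?_) (by nlinarith [mul_nonneg hαs hβs, mul_nonneg hαs hs0])
      have h3 : (1+α*s) * (1+(1+β)*s) ≤ 3 := by
        have ha : 1+α*s ≤ 3/2 := by nlinarith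
        have hb : 1+(1+β)*s ≤ 2 := by nlinarith [hβ.2]
        nlinarith [mul_le_mul ha hb (by nlinarith) (by norm_num)]
      nlinarith
    have hKs : 1/2 ≤ 3/(1-α) * y^(-α) * ((1-α)*s/3) := by
      have e : 3/(1-α) * y^(-α) * ((1-α)*s/3) = y^(-α) * s := by
        have : 1-α ≠ 0 := by linarith
        field_simp
      rw [e]
      nlinarith
    have hD : 0 < 1+(1+β)*s := by nlinarith
    calc f y / (1+(1+β)*s) + f ((x+2)/3) / 3
        ≤ 3/(1-α) * y^(-α) * M / (1+(1+β)*s) + M/2 := by gcongr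
      _ ≤ 3/(1-α) * y^(-α) * M / (1+(1+β)*s) + 3/(1-α) * y^(-α) * ((1-α)*s/3) * M := by nlinarith
      _ = 3/(1-α) * y^(-α) * M * (1/(1+(1+β)*s) + (1-α)*s/3) := by ring
      _ ≤ 3/(1-α) * y^(-α) * M * (1+s)^(-α) := by
          gcongr; exact hgap.trans hR2
      _ = 3/(1-α) * x^(-α) * M := by rw [hx']; ring

section Iterates

variable {α : ℝ} {β : ℕ → ℝ}

lemma PopCompFrom_succ' (β : ℕ → ℝ) (k n : ℕ) (f : ℝ → ℝ) :
    PopCompFrom β k (n+1) f = PopCompFrom β (k+1) n (Pop (β (k+1)) f) := by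
  induction n with
  | zero => rfl
  | succ n ih =>
    rw [PopCompFrom, ih, PopCompFrom, show k + (n+1) + 1 = k + 1 + n + 1 by ring]

lemma PopCompFrom_add_steps (β : ℕ → ℝ) (k m n : ℕ) (f : ℝ → ℝ) :
    PopCompFrom β k (m+n) f = PopCompFrom β (k+m) n (PopCompFrom β k m f) := by
  induction n with
  | zero => rfl
  | succ n ih => rw [← add_assoc, PopCompFrom, ih, PopCompFrom, add_assoc k m n]

lemma PopCompFrom_add (β : ℕ → ℝ) (k n : ℕ) (f g : ℝ → ℝ) :
    PopCompFrom β k n (fun x => f x + g x)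
      = fun x => PopCompFrom β k n f x + PopCompFrom β k n g x := by
  induction n with
  | zero => rfl
  | succ n ih => rw [PopCompFrom, ih]; funext x; simp only [PopCompFrom, Pop]; ring

lemma PopCompFrom_const_mul (β : ℕ → ℝ) (k n : ℕ) (c : ℝ) (f : ℝ → ℝ) :
    PopCompFrom β k n (fun x => c * f x) = fun x => c * PopCompFrom β k n f x := by
  induction n with
  | zero => rfl
  | succ n ih => rw [PopCompFrom, ih]; funext x; simp only [PopCompFrom, Pop]; ring

lemma PopCompFrom_sub (β : ℕ → ℝ) (k n : ℕ) (f g : ℝ → ℝ) :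
    PopCompFrom β k n (fun x => f x - g x)
      = fun x => PopCompFrom β k n f x - PopCompFrom β k n g x := by
  induction n with
  | zero => rfl
  | succ n ih => rw [PopCompFrom, ih]; funext x; simp only [PopCompFrom, Pop]; ring

lemma PopCompFrom_sum (β : ℕ → ℝ) (k n : ℕ) {ι : Type*} (s : Finset ι) (f : ι → ℝ → ℝ) :
    PopCompFrom β k n (fun x => ∑ i ∈ s, f i x)
      = fun x => ∑ i ∈ s, PopCompFrom β k n (f i) x := by
  induction n with
  | zero => rfl
  | succ n ih =>
    rw [PopCompFrom, ih]
    funext x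
    simp only [PopCompFrom, Pop, Finset.sum_div, Finset.sum_add_distrib]

lemma PopCompFrom_le (hβ : ∀ i, β i ∈ Ioc (0:ℝ) α) (k n : ℕ)
    {f g : ℝ → ℝ} (h : ∀ x ∈ Ioc (0:ℝ) 1, f x ≤ g x) :
    ∀ x ∈ Ioc (0:ℝ) 1, PopCompFrom β k n f x ≤ PopCompFrom β k n g x := by
  induction n with
  | zero => exact h
  | succ n ih => exact Pop_le_Pop (hβ _).1 ih

lemma PopCompFrom_congr (hβ : ∀ i, β i ∈ Ioc (0:ℝ) α) (k n : ℕ)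
    {f g : ℝ → ℝ} (h : EqOn f g (Ioc 0 1)) :
    EqOn (PopCompFrom β k n f) (PopCompFrom β k n g) (Ioc 0 1) := fun x hx =>
  (PopCompFrom_le hβ k n (fun _ hy => (h hy).le) x hx).antisymm
    (PopCompFrom_le hβ k n (fun _ hy => (h hy).ge) x hx)

lemma integrableOn_PopCompFrom (hβ : ∀ i, β i ∈ Ioc (0:ℝ) α) (k n : ℕ)
    {f : ℝ → ℝ} (hf : IntegrableOn f (Ioc 0 1)) :
    IntegrableOn (PopCompFrom β k n f) (Ioc 0 1) := by
  induction n with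
  | zero => exact hf
  | succ n ih => exact integrableOn_Pop (hβ _).1 ih

lemma mInt_PopCompFrom (hβ : ∀ i, β i ∈ Ioc (0:ℝ) α) (k n : ℕ)
    {f : ℝ → ℝ} (hf : IntegrableOn f (Ioc 0 1)) :
    mInt (PopCompFrom β k n f) = mInt f := by
  induction n with
  | zero => rfl
  | succ n ih => rw [PopCompFrom, mInt_Pop (hβ _).1 (integrableOn_PopCompFrom hβ k n hf), ih]

lemma L1norm_PopCompFrom_le (hβ : ∀ i, β i ∈ Ioc (0:ℝ) α) (k n : ℕ)
    {f : ℝ → ℝ} (hf : IntegrableOn f (Ioc 0 1)) :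
    L1norm (PopCompFrom β k n f) ≤ L1norm f := by
  induction n with
  | zero => exact le_rfl
  | succ n ih => exact (L1norm_Pop_le (hβ _).1 (integrableOn_PopCompFrom hβ k n hf)).trans ih

lemma IsTame.PopCompFrom (hβ : ∀ i, β i ∈ Ioc (0:ℝ) α) (hα : 0 < α)
    (hα1 : α < 1) (k n : ℕ) {f : ℝ → ℝ} (hf : IsTame α f) :
    IsTame α (PopCompFrom β k n f) := by
  induction n with
  | zero => exact hf
  | succ n ih => exact ih.Pop hα hα1 (hβ _)

end Iterates

/-- Tame functions have small mass near the neutral fixed point. -/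
lemma IsTame.integral_Ioc_le {α b : ℝ} {f : ℝ → ℝ} (hα1 : α < 1) (hf : IsTame α f)
    (hb : b ∈ Ioc (0:ℝ) 1) :
    ∫ x in Ioc 0 b, f x ≤ 3/(1-α)^2 * b^(1-α) * mInt f := by
  have hsub : Ioc 0 b ⊆ Ioc (0:ℝ) 1 := Ioc_subset_Ioc_right hb.2
  have hint : IntegrableOn (fun x : ℝ => x^(-α)) (Ioc 0 b) :=
    (intervalIntegrable_iff_integrableOn_Ioc_of_le hb.1.le).1
      (intervalIntegral.intervalIntegrable_rpow' (by linarith))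
  have hI : ∫ x in Ioc 0 b, x^(-α) = b^(1-α)/(1-α) := by
    rw [← intervalIntegral.integral_of_le hb.1.le, integral_rpow (Or.inl (by linarith)),
      Real.zero_rpow (by linarith), sub_zero, neg_add_eq_sub]
  calc ∫ x in Ioc 0 b, f x ≤ ∫ x in Ioc 0 b, (3/(1-α) * mInt f) * x^(-α) := by
        refine setIntegral_mono_on (hf.integrable.mono_set hsub) (hint.const_mul _)
          measurableSet_Ioc fun x hx => (hf.le x (hsub hx)).trans_eq (by ring)
    _ = 3/(1-α)^2 * b^(1-α) * mInt f := by
        rw [integral_const_mul, hI]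
        have : 1-α ≠ 0 := by linarith
        field_simp

/-- Tame functions are bounded below by a fixed fraction of their mean. -/
lemma exists_tame_lower_bound {α : ℝ} (hα : 0 < α) (hα1 : α < 1) :
    ∃ δ : ℝ, 0 < δ ∧ δ ≤ 1 ∧ ∀ f, IsTame α f → ∀ x ∈ Ioc (0:ℝ) 1, δ * mInt f ≤ f x := by
  have h1α : 0 < 1-α := by linarith
  set η : ℝ := ((1-α)^2/6)^(1/(1-α)) with hη
  have hη0 : 0 < η := by positivity
  have hη1 : η ≤ 1 := Real.rpow_le_one (by positivity) (by nlinarith) (by positivity)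
  have hηp : η^(1-α) = (1-α)^2/6 := by
    rw [hη, ← Real.rpow_mul (by positivity), one_div_mul_cancel h1α.ne', Real.rpow_one]
  have hηm : η ∈ Ioc (0:ℝ) 1 := ⟨hη0, hη1⟩
  have hp1 : η^(α+1) ≤ 1 := Real.rpow_le_one hη0.le hη1 (by linarith)
  have hp0 : 0 < η^(α+1) := by positivity
  refine ⟨η^(α+1)/2, by positivity, by linarith, fun f hf x hx => ?_⟩
  have hM := mInt_nonneg hf.cone.nonneg
  have h0 := hf.integral_Ioc_le hα1 hηm
  have hsplit : mInt f = (∫ x in Ioc 0 η, f x) + ∫ x in Ioc η 1, f x := by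
    rw [mInt, ← setIntegral_union (Ioc_disjoint_Ioc_of_le le_rfl) measurableSet_Ioc
      (hf.integrable.mono_set (Ioc_subset_Ioc_right hη1))
      (hf.integrable.mono_set (Ioc_subset_Ioc_left hη0.le)),
      Ioc_union_Ioc_eq_Ioc hη0.le hη1]
  have hfη := hf.cone.nonneg _ hηm
  have h2 : ∫ x in Ioc η 1, f x ≤ f η := by
    calc ∫ x in Ioc η 1, f x ≤ ∫ _ in Ioc η 1, f η :=
          setIntegral_mono_on (hf.integrable.mono_set (Ioc_subset_Ioc_left hη0.le)) (by simp)
            measurableSet_Ioc fun x hx => hf.cone.anti hηm ⟨hη0.trans hx.1, hx.2⟩ hx.1.le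
      _ = (1-η) * f η := by rw [setIntegral_const]; simp [hη1]
      _ ≤ f η := by nlinarith
  have h3 : 3/(1-α)^2 * η^(1-α) * mInt f = mInt f / 2 := by
    rw [hηp]; field_simp; ring
  have h4 := hf.cone.mono hηm ⟨zero_lt_one, le_rfl⟩ hη1
  have h5 := hf.cone.anti hx ⟨zero_lt_one, le_rfl⟩ hx.2
  simp only [Real.one_rpow, one_mul] at h4
  nlinarith

/-- The right endpoint of the leftmost cylinder of `T_{β_{k+n}} ∘ ⋯ ∘ T_{β_{k+1}}`. -/
noncomputable def leftEnd (β : ℕ → ℝ) : ℕ → ℕ → ℝ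
  | _, 0 => 1
  | k, n+1 => leftInv (β (k+1)) (leftEnd β (k+1) n)

section Cells

variable {α : ℝ} {β : ℕ → ℝ}

lemma leftEnd_mem (hβ : ∀ i, β i ∈ Ioc (0:ℝ) α) (k n : ℕ) : leftEnd β k n ∈ Ioc (0:ℝ) 1 := by
  induction n generalizing k with
  | zero => exact ⟨zero_lt_one, le_rfl⟩
  | succ n ih => exact leftInv_mem_unit (hβ _).1 (ih (k+1))

lemma mul_le_leftEnd_rpow_neg (hα : 0 < α) (hα1 : α < 1) (hβ : ∀ i, β i ∈ Ioc (0:ℝ) α) (k n : ℕ) :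
    n * (α/3) ≤ (leftEnd β k n)^(-α) := by
  induction n generalizing k with
  | zero => simp [leftEnd]
  | succ n ih =>
    have := rpow_neg_add_le_leftInv hα hα1 (hβ (k+1)) (leftEnd_mem hβ (k+1) n)
    have := ih (k+1)
    rw [leftEnd]
    push_cast
    linarith

lemma leftEnd_rpow_le (hα : 0 < α) (hα1 : α < 1) (hβ : ∀ i, β i ∈ Ioc (0:ℝ) α) (k : ℕ) {n : ℕ}
    (hn : 0 < n) : (leftEnd β k n)^(1-α) ≤ (α/3)^(1-1/α) * (n:ℝ)^(1-1/α) := by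
  have h := mul_le_leftEnd_rpow_neg hα hα1 hβ k n
  have hn' : (0:ℝ) < n := by exact_mod_cast hn
  have hm := leftEnd_mem hβ k n
  have e : (leftEnd β k n)^(1-α) = ((leftEnd β k n)^(-α))^(1-1/α) := by
    rw [← Real.rpow_mul hm.1.le]
    congr 1
    field_simp
    ring
  have hexp : 1 - 1/α ≤ 0 := by
    rw [sub_nonpos, le_div_iff₀ hα]; linarith
  rw [e, ← Real.mul_rpow (by positivity) hn'.le, mul_comm (α/3)]
  exact Real.rpow_le_rpow_of_nonpos (by positivity) h hexp

/-- Minorization: the iterates of a cone function are bounded below by a fixed fraction of its mass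
outside the leftmost cylinder. -/
lemma exists_minorization (hα : 0 < α) (hα1 : α < 1) :
    ∃ γ : ℝ, 0 < γ ∧ γ ≤ 1 ∧ ∀ β : ℕ → ℝ, (∀ i, β i ∈ Ioc (0:ℝ) α) → ∀ (n k : ℕ) (F : ℝ → ℝ),
      IsCone α F → IntegrableOn F (Ioc 0 1) → ∀ x ∈ Ioc (0:ℝ) 1,
        γ * (mInt F - ∫ y in Ioc 0 (leftEnd β k n), F y) ≤ PopCompFrom β k n F x := by
  obtain ⟨δ, hδ0, hδ1, hδ⟩ := exists_tame_lower_bound hα hα1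
  refine ⟨4/9*δ, by positivity, by linarith, fun β hβ n => ?_⟩
  induction n with
  | zero =>
    intro k F hF hFi x hx
    have : mInt F - ∫ y in Ioc 0 (leftEnd β k 0), F y = 0 := sub_self _
    rw [this, mul_zero]
    exact hF.nonneg x hx
  | succ n ih =>
    intro k F hF hFi x hx
    have hb := hβ (k+1)
    rw [PopCompFrom_succ', Pop_eq, PopCompFrom_add, leftEnd,
      ← integral_leftOp hb.1 (Ioc_subset_Icc_self (leftEnd_mem hβ (k+1) n)),
      ← mInt_leftOp_add_rightOp hb.1 hFi]
    have h1 := ih (k+1) _ (hF.leftOp hα hb) (integrableOn_leftOp hb.1 hFi) x hx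
    have hR := hF.rightOp hα
    have hRi := integrableOn_rightOp hFi
    have hone : (1:ℝ) ∈ Ioc (0:ℝ) 1 := ⟨zero_lt_one, le_rfl⟩
    have hmR : mInt (rightOp F) ≤ 9/4 * rightOp F 1 := by
      have hbd : ∀ y ∈ Ioc (0:ℝ) 1, rightOp F y ≤ 9/4 * rightOp F 1 := by
        intro y hy
        have h2 := hF.mono (right_mem_unit hy) hone (right_mem_unit hy).2
        have h3 : (2/3:ℝ)^(2:ℝ) ≤ ((y+2)/3)^(α+1) :=
          (Real.rpow_le_rpow_of_exponent_ge (by norm_num) (by norm_num) (by linarith)).trans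
            (Real.rpow_le_rpow (by norm_num) (right_mem_Ioc hy).1.le (by linarith))
        have h4 := hF.nonneg _ (right_mem_unit hy)
        norm_num at h2 h3 ⊢
        unfold rightOp
        norm_num
        nlinarith
      have hci : IntegrableOn (fun _ => 9/4 * rightOp F 1) (Ioc (0:ℝ) 1) :=
        integrableOn_const (by simp)
      calc mInt (rightOp F) ≤ ∫ _ in Ioc (0:ℝ) 1, 9/4 * rightOp F 1 :=
            setIntegral_mono_on hRi hci measurableSet_Ioc hbd
        _ = 9/4 * rightOp F 1 := by rw [setIntegral_const]; simp
    have h5 := PopCompFrom_le hβ (k+1) n (f := fun _ => rightOp F 1 * 1) (g := rightOp F)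
      (fun y hy => by simpa using hR.anti hy hone hy.2) x hx
    rw [PopCompFrom_const_mul] at h5
    have h6 := hδ _ ((IsTame.one hα hα1).PopCompFrom hβ hα hα1 (k+1) n) x hx
    rw [mInt_PopCompFrom hβ _ _ (IsTame.one hα hα1).integrable] at h6
    have h7 : mInt (fun _ => 1) = 1 := by simp [mInt]
    rw [h7] at h6
    have h8 := hR.nonneg 1 hone
    nlinarith

/-- A partition `0 = p 0 < p 1 < ⋯ < p N = 1` whose first cell is the longest one. -/
structure IsPartition (N : ℕ) (p : ℕ → ℝ) : Prop where
  pos : 0 < N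
  zero : p 0 = 0
  last : p N = 1
  lt : ∀ i < N, p i < p (i+1)
  le : ∀ i < N, p (i+1) - p i ≤ p 1

namespace IsPartition

variable {N : ℕ} {p : ℕ → ℝ}

lemma mono (hp : IsPartition N p) {i j : ℕ} (hij : i ≤ j) (hj : j ≤ N) : p i ≤ p j := by
  induction j, hij using Nat.le_induction with
  | base => exact le_rfl
  | succ j _ ih => exact (ih (by omega)).trans (hp.lt j (by omega)).le

lemma mem_Icc (hp : IsPartition N p) {i : ℕ} (hi : i ≤ N) : p i ∈ Icc (0:ℝ) 1 :=
  ⟨hp.zero ▸ hp.mono (Nat.zero_le i) hi, hp.last ▸ hp.mono hi le_rfl⟩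

lemma cell_subset (hp : IsPartition N p) {i : ℕ} (hi : i < N) :
    Ioc (p i) (p (i+1)) ⊆ Ioc 0 1 :=
  Ioc_subset_Ioc (hp.mem_Icc hi.le).1 (hp.mem_Icc (i := i+1) hi).2

lemma sum_indicator (hp : IsPartition N p) (g : ℝ → ℝ) {x : ℝ} (hx : x ∈ Ioc (0:ℝ) 1) :
    ∑ i ∈ Finset.range N, (Ioc (p i) (p (i+1))).indicator g x = g x := by
  have h : ∀ i ∈ Finset.range N, (Ioc (p i) (p (i+1))).indicator g x
      = (Ioc 0 (p (i+1))).indicator g x - (Ioc 0 (p i)).indicator g x := by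
    intro i hi
    have hi := Finset.mem_range.1 hi
    have h0 := (hp.mem_Icc hi.le).1
    have h1 := hp.lt i hi
    simp only [indicator_apply, mem_Ioc, hx.1, true_and]
    split_ifs <;> first | (exfalso; grind) | simp
  rw [Finset.sum_congr rfl h, Finset.sum_range_sub (fun i => (Ioc 0 (p i)).indicator g x),
    hp.last, hp.zero, indicator_of_mem hx]
  simp

lemma setIntegral_indicator_cell (hp : IsPartition N p) (g : ℝ → ℝ) {i : ℕ} (hi : i < N) :
    mInt ((Ioc (p i) (p (i+1))).indicator g) = ∫ x in Ioc (p i) (p (i+1)), g x := by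
  rw [mInt, setIntegral_indicator measurableSet_Ioc,
    inter_eq_self_of_subset_right (hp.cell_subset hi)]

lemma sum_integral_cell (hp : IsPartition N p) {g : ℝ → ℝ} (hg : IntegrableOn g (Ioc 0 1)) :
    ∑ i ∈ Finset.range N, ∫ x in Ioc (p i) (p (i+1)), g x = mInt g := by
  have h : mInt g = ∫ x in Ioc 0 1, ∑ i ∈ Finset.range N, (Ioc (p i) (p (i+1))).indicator g x :=
    setIntegral_congr_fun measurableSet_Ioc fun x hx => (hp.sum_indicator g hx).symm
  rw [h, integral_finsetSum _ fun i _ => hg.indicator measurableSet_Ioc]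
  exact Finset.sum_congr rfl fun i hi =>
    (hp.setIntegral_indicator_cell g (Finset.mem_range.1 hi)).symm

end IsPartition

/-- The partition into `n`-cylinders: the first cell is the longest, and all cells are mapped
onto `(0,1]`, with the cone preserved by each inverse branch. -/
lemma exists_cells (hα : 0 < α) (hβ : ∀ i, β i ∈ Ioc (0:ℝ) α) (n k : ℕ) :
    ∃ (N : ℕ) (p : ℕ → ℝ), IsPartition N p ∧ p 1 = leftEnd β k n ∧
      ∀ u, IsCone α u → ∀ i < N,
        IsCone α (PopCompFrom β k n ((Ioc (p i) (p (i+1))).indicator u)) := by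
  induction n generalizing k with
  | zero =>
    refine ⟨1, fun i => i, ⟨one_pos, by simp, by simp, by simp, by simp⟩, by simp [leftEnd], ?_⟩
    intro u hu i hi
    obtain rfl : i = 0 := by omega
    refine hu.congr fun x hx => ?_
    simp only [PopCompFrom]
    rw [indicator_of_mem (by simpa using hx)]
  | succ n ih =>
    obtain ⟨N, p, hp, hp1, hcone⟩ := ih (k+1)
    have hb := hβ (k+1)
    set b := β (k+1) with hbdef
    set q : ℕ → ℝ := fun i => if i ≤ N then leftInv b (p i) else (p (i-N)+2)/3 with hq
    have hqL : ∀ i ≤ N, q i = leftInv b (p i) := fun i hi => by simp [hq, hi]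
    have hqR : ∀ j, q (N+j) = (p j + 2)/3 := by
      intro j
      rcases Nat.eq_zero_or_pos j with rfl | hj
      · rw [add_zero, hqL N le_rfl, hp.last, leftInv_one hb.1, hp.zero]; norm_num
      · have : ¬ N + j ≤ N := by omega
        simp [hq, hj.ne']
    have hq1 : q 1 = leftEnd β k (n+1) := by rw [hqL 1 hp.pos, hp1, leftEnd]
    have hp1m := hp.mem_Icc (i := 1) hp.pos
    have hq1' : q 1 = leftInv b (p 1) := hqL 1 hp.pos
    have hlow := two_thirds_mul_le_leftInv hb.1 hp1m
    have hlt : ∀ i < N, q i < q (i+1) := fun i hi => by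
      rw [hqL i hi.le, hqL (i+1) hi]
      exact leftInv_strictMonoOn hb.1 (hp.mem_Icc hi.le) (hp.mem_Icc (i := i+1) hi) (hp.lt i hi)
    have hcases : ∀ i < N + N, i < N ∨ ∃ j < N, i = N + j := fun i hi => by
      rcases lt_or_ge i N with h | h
      · exact Or.inl h
      · exact Or.inr ⟨i - N, by omega, by omega⟩
    refine ⟨N + N, q, ⟨by have := hp.pos; omega, ?_, ?_, ?_, ?_⟩, hq1, ?_⟩
    · rw [hqL 0 (Nat.zero_le _), hp.zero, leftInv_zero hb.1]
    · rw [hqR, hp.last]; norm_num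
    · intro i hi
      rcases hcases i hi with h | ⟨j, hj, rfl⟩
      · exact hlt i h
      · rw [add_assoc, hqR, hqR]
        linarith [hp.lt j hj]
    · intro i hi
      rw [hq1']
      rcases hcases i hi with h | ⟨j, hj, rfl⟩
      · have hi0 := hp.mem_Icc h.le
        have hi1 := hp.mem_Icc (i := i+1) h
        have hlt' := hp.lt i h
        rw [hqL i h.le, hqL (i+1) h]
        refine (leftInv_sub_le hb.1 hi0.1 hlt'.le hi1.2).trans ?_
        exact (leftInv_strictMonoOn hb.1).monotoneOn ⟨by linarith, by linarith [hi0.1, hi1.2]⟩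
          hp1m (hp.le i h)
      · rw [add_assoc, hqR, hqR]
        have := hp.le j hj
        linarith [hp1m.1]
    · intro u hu i hi
      rw [PopCompFrom_succ', ← hbdef]
      rcases hcases i hi with h | ⟨j, hj, rfl⟩
      · refine (hcone _ (hu.leftOp hα hb) i h).congr (PopCompFrom_congr hβ _ _ fun x hx => ?_)
        have hi0 := hp.mem_Icc h.le
        have hi1 := hp.mem_Icc (i := i+1) h
        have hr : (x+2)/3 ∉ Ioc (q i) (q (i+1)) := fun hc => by
          have h1 := hc.2
          rw [hqL (i+1) h] at h1
          linarith [(leftInv_mem_Icc hb.1 hi1).2, (right_mem_Ioc hx).1]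
        have hxc := Ioc_subset_Icc_self hx
        have hl : leftInv b x ∈ Ioc (q i) (q (i+1)) ↔ x ∈ Ioc (p i) (p (i+1)) := by
          rw [hqL i h.le, hqL (i+1) h]
          exact and_congr ((leftInv_strictMonoOn hb.1).lt_iff_lt hi0 hxc)
            ((leftInv_strictMonoOn hb.1).le_iff_le hxc hi1)
        rw [Pop, indicator_of_notMem hr]
        by_cases hxi : x ∈ Ioc (p i) (p (i+1))
        · rw [indicator_of_mem hxi, indicator_of_mem (hl.2 hxi), leftOp]; simp
        · rw [indicator_of_notMem hxi, indicator_of_notMem (mt hl.1 hxi)]; simp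
      · refine (hcone _ (hu.rightOp hα) j hj).congr (PopCompFrom_congr hβ _ _ fun x hx => ?_)
        have hj0 := hp.mem_Icc hj.le
        have hl : leftInv b x ∉ Ioc (q (N+j)) (q (N+j+1)) := fun hc => by
          have h1 := hc.1
          rw [hqR] at h1
          linarith [(leftInv_mem_Ioc hb.1 hx).2, hj0.1]
        have hr : (x+2)/3 ∈ Ioc (q (N+j)) (q (N+j+1)) ↔ x ∈ Ioc (p j) (p (j+1)) := by
          rw [add_assoc, hqR, hqR]
          constructor <;> rintro ⟨h1, h2⟩ <;> constructor <;> linarith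
        rw [Pop, indicator_of_notMem hl]
        by_cases hxi : x ∈ Ioc (p j) (p (j+1))
        · rw [indicator_of_mem hxi, indicator_of_mem (hr.2 hxi), rightOp]; simp
        · rw [indicator_of_notMem hxi, indicator_of_notMem (mt hr.1 hxi)]; simp

end Cells

/-- The average of `f` over the `i`-th cell of the partition `p`. -/
noncomputable def cellAvg (p : ℕ → ℝ) (f : ℝ → ℝ) (i : ℕ) : ℝ :=
  (∫ x in Ioc (p i) (p (i+1)), f x) / (p (i+1) - p i)

/-- The function with value `c i` on the `i`-th cell of the partition `p` into `N` cells. -/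
noncomputable def stepFun (N : ℕ) (p : ℕ → ℝ) (c : ℕ → ℝ) (x : ℝ) : ℝ :=
  ∑ i ∈ Finset.range N, c i * (Ioc (p i) (p (i+1))).indicator (fun _ => 1) x

/-- The conditional expectation of `f` with respect to the partition `p` into `N` cells. -/
noncomputable def stepAvg (N : ℕ) (p : ℕ → ℝ) (f : ℝ → ℝ) : ℝ → ℝ :=
  stepFun N p (cellAvg p f)

lemma integrableOn_indicator_one (a b : ℝ) :
    IntegrableOn ((Ioc a b).indicator fun _ => (1:ℝ)) (Ioc 0 1) :=
  (integrableOn_const (by simp)).indicator measurableSet_Ioc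

lemma integrableOn_stepFun (N : ℕ) (p c : ℕ → ℝ) : IntegrableOn (stepFun N p c) (Ioc 0 1) :=
  integrable_finsetSum _ fun _ _ => (integrableOn_indicator_one _ _).const_mul _

lemma stepFun_le {N : ℕ} {p c d : ℕ → ℝ} (h : ∀ i < N, c i ≤ d i) (x : ℝ) :
    stepFun N p c x ≤ stepFun N p d x :=
  Finset.sum_le_sum fun i hi => mul_le_mul_of_nonneg_right (h i (Finset.mem_range.1 hi))
    (indicator_nonneg (fun _ _ => zero_le_one) x)

lemma L1norm_add_le {f g : ℝ → ℝ} (hf : IntegrableOn f (Ioc 0 1)) (hg : IntegrableOn g (Ioc 0 1)) :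
    L1norm (fun x => f x + g x) ≤ L1norm f + L1norm g := by
  rw [L1norm, L1norm, L1norm, ← integral_add hf.abs hg.abs]
  exact setIntegral_mono_on (hf.add hg).abs (hf.abs.add hg.abs) measurableSet_Ioc
    fun x _ => abs_add_le _ _

lemma L1norm_sub_le {f g : ℝ → ℝ} (hf : IntegrableOn f (Ioc 0 1)) (hg : IntegrableOn g (Ioc 0 1)) :
    L1norm (fun x => f x - g x) ≤ L1norm f + L1norm g := by
  have := L1norm_add_le hf hg.neg
  simpa [L1norm, sub_eq_add_neg] using this

lemma L1norm_sub_comm (f g : ℝ → ℝ) :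
    L1norm (fun x => f x - g x) = L1norm (fun x => g x - f x) := by
  simp only [L1norm, abs_sub_comm]

namespace IsPartition

variable {N : ℕ} {p : ℕ → ℝ}

lemma cellAvg_mul (hp : IsPartition N p) (f : ℝ → ℝ) {i : ℕ} (hi : i < N) :
    cellAvg p f i * (p (i+1) - p i) = ∫ x in Ioc (p i) (p (i+1)), f x :=
  div_mul_cancel₀ _ (sub_pos.2 (hp.lt i hi)).ne'

lemma cellAvg_le (hp : IsPartition N p) {f : ℝ → ℝ} (hf : IntegrableOn f (Ioc 0 1)) {i : ℕ}
    (hi : i < N) {c : ℝ} (h : ∀ x ∈ Ioc (p i) (p (i+1)), f x ≤ c) : cellAvg p f i ≤ c := by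
  have hlt := hp.lt i hi
  rw [cellAvg, div_le_iff₀ (sub_pos.2 hlt)]
  calc ∫ x in Ioc (p i) (p (i+1)), f x ≤ ∫ _ in Ioc (p i) (p (i+1)), c :=
        setIntegral_mono_on (hf.mono_set (hp.cell_subset hi)) (integrableOn_const (by simp))
          measurableSet_Ioc h
    _ = c * (p (i+1) - p i) := by rw [setIntegral_const]; simp [hlt.le, mul_comm]

lemma le_cellAvg (hp : IsPartition N p) {f : ℝ → ℝ} (hf : IntegrableOn f (Ioc 0 1)) {i : ℕ}
    (hi : i < N) {c : ℝ} (h : ∀ x ∈ Ioc (p i) (p (i+1)), c ≤ f x) : c ≤ cellAvg p f i := by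
  have hlt := hp.lt i hi
  rw [cellAvg, le_div_iff₀ (sub_pos.2 hlt)]
  calc c * (p (i+1) - p i) = ∫ _ in Ioc (p i) (p (i+1)), c := by
        rw [setIntegral_const]; simp [hlt.le, mul_comm]
    _ ≤ ∫ x in Ioc (p i) (p (i+1)), f x :=
        setIntegral_mono_on (integrableOn_const (by simp)) (hf.mono_set (hp.cell_subset hi))
          measurableSet_Ioc h

lemma cellAvg_nonneg (hp : IsPartition N p) {α : ℝ} {f : ℝ → ℝ} (hf : IsTame α f) {i : ℕ}
    (hi : i < N) : 0 ≤ cellAvg p f i :=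
  hp.le_cellAvg hf.integrable hi fun x hx => hf.cone.nonneg x (hp.cell_subset hi hx)

lemma integrableOn_cell_abs_sub_const (hp : IsPartition N p) {f : ℝ → ℝ}
    (hf : IntegrableOn f (Ioc 0 1)) {i : ℕ} (hi : i < N) (c : ℝ) :
    IntegrableOn (fun x => |f x - c|) (Ioc (p i) (p (i+1))) :=
  ((hf.mono_set (hp.cell_subset hi)).sub (integrableOn_const (by simp))).abs

lemma L1norm_sub_stepAvg_le_sum (hp : IsPartition N p) {f : ℝ → ℝ}
    (hf : IntegrableOn f (Ioc 0 1)) :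
    L1norm (fun x => f x - stepAvg N p f x)
      ≤ ∑ i ∈ Finset.range N, ∫ x in Ioc (p i) (p (i+1)), |f x - cellAvg p f i| := by
  have hint : ∀ i, IntegrableOn ((Ioc (p i) (p (i+1))).indicator
      fun x => |f x - cellAvg p f i|) (Ioc 0 1) := fun i =>
    (hf.sub (integrableOn_const (by simp))).abs.indicator measurableSet_Ioc
  calc L1norm (fun x => f x - stepAvg N p f x)
      ≤ ∫ x in Ioc 0 1, ∑ i ∈ Finset.range N,
          (Ioc (p i) (p (i+1))).indicator (fun x => |f x - cellAvg p f i|) x := by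
        refine setIntegral_mono_on (hf.sub (integrableOn_stepFun N p _)).abs
          (integrable_finsetSum _ fun i _ => hint i) measurableSet_Ioc fun x hx => ?_
        have e : f x - stepAvg N p f x = ∑ i ∈ Finset.range N,
            (Ioc (p i) (p (i+1))).indicator (fun x => f x - cellAvg p f i) x := by
          rw [← hp.sum_indicator f hx, stepAvg, stepFun, ← Finset.sum_sub_distrib]
          refine Finset.sum_congr rfl fun i _ => ?_
          by_cases hxi : x ∈ Ioc (p i) (p (i+1)) <;> simp [indicator, hxi]
        change |f x - stepAvg N p f x| ≤ _
        rw [e]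
        refine (Finset.abs_sum_le_sum_abs _ _).trans_eq (Finset.sum_congr rfl fun i _ => ?_)
        by_cases hxi : x ∈ Ioc (p i) (p (i+1)) <;> simp [indicator, hxi]
    _ = _ := by
        rw [integral_finsetSum _ fun i _ => hint i]
        exact Finset.sum_congr rfl fun i hi =>
          hp.setIntegral_indicator_cell _ (Finset.mem_range.1 hi)

/-- Tame functions are close to their conditional expectations. -/
lemma L1norm_sub_stepAvg_le (hp : IsPartition N p) {α : ℝ} {f : ℝ → ℝ} (hα : 0 < α) (hα1 : α < 1)
    (hf : IsTame α f) :
    L1norm (fun x => f x - stepAvg N p f x) ≤ 9/(1-α)^2 * (p 1)^(1-α) * mInt f := by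
  have h1α : 0 < 1-α := by linarith
  have hM := mInt_nonneg hf.cone.nonneg
  have hp1 : p 1 ∈ Ioc (0:ℝ) 1 :=
    ⟨by have := hp.lt 0 hp.pos; rwa [hp.zero] at this, (hp.mem_Icc (i := 1) hp.pos).2⟩
  obtain ⟨m, rfl⟩ : ∃ m, N = m + 1 := ⟨N - 1, by have := hp.pos; omega⟩
  refine (hp.L1norm_sub_stepAvg_le_sum hf.integrable).trans ?_
  rw [Finset.sum_range_succ']
  have h0 : ∫ x in Ioc (p 0) (p (0+1)), |f x - cellAvg p f 0|
      ≤ 2 * ∫ x in Ioc 0 (p 1), f x := by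
    have hA := hp.cellAvg_mul f hp.pos
    have hlt := hp.lt 0 hp.pos
    have hi0 := hf.integrable.mono_set (hp.cell_subset hp.pos)
    calc ∫ x in Ioc (p 0) (p (0+1)), |f x - cellAvg p f 0|
        ≤ ∫ x in Ioc (p 0) (p (0+1)), (f x + cellAvg p f 0) := by
          refine setIntegral_mono_on (hp.integrableOn_cell_abs_sub_const hf.integrable hp.pos _)
            (hi0.add (integrableOn_const (by simp))) measurableSet_Ioc fun x hx => ?_
          have h1 := hf.cone.nonneg x (hp.cell_subset hp.pos hx)
          have h2 := hp.cellAvg_nonneg hf hp.pos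
          rw [abs_le]; constructor <;> linarith
      _ = (∫ x in Ioc (p 0) (p (0+1)), f x) + cellAvg p f 0 * (p (0+1) - p 0) := by
          rw [integral_add hi0 (integrableOn_const (by simp)), setIntegral_const]
          simp [hlt.le, mul_comm]
      _ = 2 * ∫ x in Ioc 0 (p 1), f x := by rw [hA, hp.zero, zero_add]; ring
  have hS : ∀ i ∈ Finset.range m, ∫ x in Ioc (p (i+1)) (p (i+1+1)), |f x - cellAvg p f (i+1)|
      ≤ p 1 * f (p (i+1)) - p 1 * f (p (i+1+1)) := by
    intro i hi
    have hi : i + 1 < m + 1 := by have := Finset.mem_range.1 hi; omega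
    have hlt := hp.lt _ hi
    have hl1 : p (i+1) ∈ Ioc (0:ℝ) 1 :=
      ⟨hp1.1.trans_le (hp.mono (by omega) hi.le), (hp.mem_Icc hi.le).2⟩
    have hl2 : p (i+1+1) ∈ Ioc (0:ℝ) 1 := ⟨hl1.1.trans hlt, (hp.mem_Icc (i := i+1+1) hi).2⟩
    have hub : ∀ x ∈ Ioc (p (i+1)) (p (i+1+1)), f x ≤ f (p (i+1)) := fun x hx =>
      hf.cone.anti hl1 (hp.cell_subset hi hx) hx.1.le
    have hlb : ∀ x ∈ Ioc (p (i+1)) (p (i+1+1)), f (p (i+1+1)) ≤ f x := fun x hx =>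
      hf.cone.anti (hp.cell_subset hi hx) hl2 hx.2
    have hcu := hp.cellAvg_le hf.integrable hi hub
    have hcl := hp.le_cellAvg hf.integrable hi hlb
    calc ∫ x in Ioc (p (i+1)) (p (i+1+1)), |f x - cellAvg p f (i+1)|
        ≤ ∫ _ in Ioc (p (i+1)) (p (i+1+1)), (f (p (i+1)) - f (p (i+1+1))) := by
          refine setIntegral_mono_on (hp.integrableOn_cell_abs_sub_const hf.integrable hi _)
            (integrableOn_const (by simp)) measurableSet_Ioc fun x hx => ?_
          have h1 := hub x hx
          have h2 := hlb x hx
          rw [abs_le]; constructor <;> linarith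
      _ = (p (i+1+1) - p (i+1)) * (f (p (i+1)) - f (p (i+1+1))) := by
          rw [setIntegral_const]; simp [hlt.le]
      _ ≤ p 1 * (f (p (i+1)) - f (p (i+1+1))) :=
          mul_le_mul_of_nonneg_right (hp.le _ hi) (by linarith)
      _ = _ := by ring
  have hsum := Finset.sum_le_sum hS
  rw [Finset.sum_range_sub' (fun i => p 1 * f (p (i+1)))] at hsum
  have hlast : 0 ≤ p 1 * f (p (m+1)) := by
    rw [hp.last]
    exact mul_nonneg hp1.1.le (hf.cone.nonneg 1 ⟨zero_lt_one, le_rfl⟩)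
  have htail := hf.integral_Ioc_le hα1 hp1
  have hfp : p 1 * f (p 1) ≤ 3/(1-α) * (p 1)^(1-α) * mInt f := by
    have e : (p 1)^(1-α) = p 1 * (p 1)^(-α) := by
      rw [sub_eq_add_neg, Real.rpow_add hp1.1, Real.rpow_one]
    rw [e]
    have := mul_le_mul_of_nonneg_left (hf.le _ hp1) hp1.1.le
    linarith
  have hK : 3/(1-α) ≤ 3/(1-α)^2 := by
    apply div_le_div_of_nonneg_left (by norm_num) (by positivity); nlinarith
  have hP : 0 ≤ (p 1)^(1-α) * mInt f := mul_nonneg (Real.rpow_nonneg hp1.1.le _) hM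
  have hK2 := mul_le_mul_of_nonneg_right hK hP
  have e9 : 9/(1-α)^2 * (p 1)^(1-α) * mInt f = 3 * (3/(1-α)^2 * ((p 1)^(1-α) * mInt f)) := by ring
  rw [e9]
  simp only [zero_add] at hsum h0 ⊢
  linarith

end IsPartition

/-- Coupling of two cone functions with the same mean through a common lower bound. -/
lemma L1norm_le_of_le {F G : ℝ → ℝ} {c : ℝ} (hF : IntegrableOn F (Ioc 0 1))
    (hG : IntegrableOn G (Ioc 0 1)) (hFc : ∀ x ∈ Ioc (0:ℝ) 1, c ≤ F x)
    (hGc : ∀ x ∈ Ioc (0:ℝ) 1, c ≤ G x) :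
    L1norm (fun x => F x - G x) ≤ mInt F + mInt G - 2 * c := by
  have hc : IntegrableOn (fun _ => 2 * c) (Ioc (0:ℝ) 1) := integrableOn_const (by simp)
  calc L1norm (fun x => F x - G x) ≤ ∫ x in Ioc (0:ℝ) 1, (F x + G x - 2 * c) := by
        refine setIntegral_mono_on (hF.sub hG).abs ((hF.add hG).sub hc) measurableSet_Ioc
          fun x hx => ?_
        have h1 := hFc x hx
        have h2 := hGc x hx
        rw [abs_le]; constructor <;> linarith
    _ = mInt F + mInt G - 2 * c := by
        have e1 : ∫ x in Ioc (0:ℝ) 1, (F x + G x - 2 * c)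
            = (∫ x in Ioc (0:ℝ) 1, (F x + G x)) - ∫ _ in Ioc (0:ℝ) 1, 2 * c :=
          integral_sub (hF.add hG) hc
        rw [e1, integral_add hF hG, setIntegral_const]
        simp [mInt]

lemma setIntegral_le_add_L1norm {f g : ℝ → ℝ} {b : ℝ} (hb : b ≤ 1) (hf : IntegrableOn f (Ioc 0 1))
    (hg : IntegrableOn g (Ioc 0 1)) :
    ∫ x in Ioc 0 b, f x ≤ (∫ x in Ioc 0 b, g x) + L1norm (fun x => f x - g x) := by
  have hsub : Ioc 0 b ⊆ Ioc (0:ℝ) 1 := Ioc_subset_Ioc_right hb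
  have hd : IntegrableOn (fun x => |f x - g x|) (Ioc 0 1) := (hf.sub hg).abs
  calc ∫ x in Ioc 0 b, f x ≤ ∫ x in Ioc 0 b, (g x + |f x - g x|) :=
        setIntegral_mono_on (hf.mono_set hsub) ((hg.mono_set hsub).add (hd.mono_set hsub))
          measurableSet_Ioc fun x _ => by linarith [le_abs_self (f x - g x)]
    _ = (∫ x in Ioc 0 b, g x) + ∫ x in Ioc 0 b, |f x - g x| :=
        integral_add (hg.mono_set hsub) (hd.mono_set hsub)
    _ ≤ _ := by
        gcongr
        exact setIntegral_mono_set hd (Filter.Eventually.of_forall fun x => abs_nonneg _)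
          hsub.eventuallyLE

lemma IsPartition.mInt_stepFun {N : ℕ} {p : ℕ → ℝ} (hp : IsPartition N p) (c : ℕ → ℝ) :
    mInt (stepFun N p c) = ∑ i ∈ Finset.range N, c i * (p (i+1) - p i) := by
  have e : mInt (stepFun N p c) = ∑ i ∈ Finset.range N,
      ∫ x in Ioc 0 1, c i * (Ioc (p i) (p (i+1))).indicator (fun _ => 1) x :=
    integral_finsetSum _ fun i _ => (integrableOn_indicator_one _ _).const_mul _
  rw [e]
  refine Finset.sum_congr rfl fun i hi => ?_
  have hi := Finset.mem_range.1 hi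
  have h := hp.setIntegral_indicator_cell (fun _ => 1) hi
  rw [mInt, setIntegral_const] at h
  rw [integral_const_mul, h]
  simp [(hp.lt i hi).le]

lemma IsPartition.mInt_stepAvg {N : ℕ} {p : ℕ → ℝ} (hp : IsPartition N p) {f : ℝ → ℝ}
    (hf : IntegrableOn f (Ioc 0 1)) : mInt (stepAvg N p f) = mInt f := by
  rw [stepAvg, hp.mInt_stepFun, ← hp.sum_integral_cell hf]
  exact Finset.sum_congr rfl fun i hi => hp.cellAvg_mul f (Finset.mem_range.1 hi)

lemma IsPartition.sum_abs_cellAvg_sub_le {N : ℕ} {p : ℕ → ℝ} (hp : IsPartition N p) {f g : ℝ → ℝ}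
    (hf : IntegrableOn f (Ioc 0 1)) (hg : IntegrableOn g (Ioc 0 1)) :
    ∑ i ∈ Finset.range N, |cellAvg p f i - cellAvg p g i| * (p (i+1) - p i)
      ≤ L1norm (fun x => f x - g x) := by
  have hd : IntegrableOn (fun x => |f x - g x|) (Ioc 0 1) := (hf.sub hg).abs
  have e : L1norm (fun x => f x - g x) = mInt (fun x => |f x - g x|) := rfl
  rw [e, ← hp.sum_integral_cell hd]
  refine Finset.sum_le_sum fun i hi => ?_
  have hi := Finset.mem_range.1 hi
  have hs := hp.cell_subset hi
  have h0 : 0 ≤ p (i+1) - p i := by linarith [hp.lt i hi]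
  calc |cellAvg p f i - cellAvg p g i| * (p (i+1) - p i)
      = |(cellAvg p f i - cellAvg p g i) * (p (i+1) - p i)| := by rw [abs_mul, abs_of_nonneg h0]
    _ = |∫ x in Ioc (p i) (p (i+1)), (f x - g x)| := by
        rw [sub_mul, hp.cellAvg_mul f hi, hp.cellAvg_mul g hi,
          integral_sub (hf.mono_set hs) (hg.mono_set hs)]
    _ ≤ _ := abs_integral_le_integral_abs

lemma IsTame.integral_PopCompFrom_stepAvg_le {α : ℝ} {β : ℕ → ℝ} {N : ℕ} {p : ℕ → ℝ}
    (hβ : ∀ i, β i ∈ Ioc (0:ℝ) α) (hp : IsPartition N p)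
    (hα : 0 < α) (hα1 : α < 1) {f : ℝ → ℝ} (hf : IsTame α f) (k n : ℕ) {b : ℝ}
    (hb : b ∈ Ioc (0:ℝ) 1) :
    ∫ x in Ioc 0 b, _root_.PopCompFrom β k n (stepAvg N p f) x
      ≤ 3/(1-α)^2 * b^(1-α) * mInt f + 9/(1-α)^2 * (p 1)^(1-α) * mInt f := by
  have hi := integrableOn_stepFun N p (cellAvg p f)
  have hPf := hf.PopCompFrom hβ hα hα1 k n
  refine (setIntegral_le_add_L1norm hb.2 (integrableOn_PopCompFrom hβ k n hi)
    hPf.integrable).trans (add_le_add ?_ ?_)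
  · have := hPf.integral_Ioc_le hα1 hb
    rwa [mInt_PopCompFrom hβ k n hf.integrable] at this
  · have h := L1norm_PopCompFrom_le hβ k n (hi.sub hf.integrable)
    have e : (stepFun N p (cellAvg p f) - f) = fun x => stepAvg N p f x - f x := rfl
    rw [e, PopCompFrom_sub, L1norm_sub_comm (stepAvg N p f) f] at h
    exact h.trans (hp.L1norm_sub_stepAvg_le hα hα1 hf)

lemma isCone_PopCompFrom_stepFun {α : ℝ} {β : ℕ → ℝ} {k n N : ℕ} {p c : ℕ → ℝ} (hα : 0 < α)
    (h : ∀ u, IsCone α u → ∀ i < N,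
      IsCone α (PopCompFrom β k n ((Ioc (p i) (p (i+1))).indicator u)))
    (hc : ∀ i, 0 ≤ c i) : IsCone α (PopCompFrom β k n (stepFun N p c)) := by
  have e : stepFun N p c
      = fun x => ∑ i ∈ Finset.range N, c i * (Ioc (p i) (p (i+1))).indicator (fun _ => 1) x := rfl
  rw [e, PopCompFrom_sum]
  refine .sum _ fun i hi => ?_
  rw [PopCompFrom_const_mul]
  exact (h _ (.one hα) i (Finset.mem_range.1 hi)).const_mul (hc i)

/-- Two tame functions with the same mean get closer by a fixed factor after `2l` steps, up to
an error polynomially small in `l`. -/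
theorem exists_block_contraction {α : ℝ} (hα : 0 < α) (hα1 : α < 1) :
    ∃ γ C : ℝ, 0 < γ ∧ γ ≤ 1 ∧ 0 ≤ C ∧ ∀ β : ℕ → ℝ, (∀ i, β i ∈ Ioc (0:ℝ) α) →
      ∀ k l : ℕ, 0 < l → ∀ f g : ℝ → ℝ, IsTame α f → IsTame α g → mInt f = mInt g →
        L1norm (PopCompFrom β k (l+l) fun x => f x - g x)
          ≤ (1-γ) * L1norm (fun x => f x - g x) + C * (l:ℝ)^(1-1/α) * mInt f := by
  obtain ⟨γ, hγ0, hγ1, hmin⟩ := exists_minorization hα hα1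
  have h1α : 0 < 1-α := by linarith
  set K : ℝ := 9/(1-α)^2 with hK
  have hK0 : 0 ≤ K := by positivity
  set D : ℝ := (α/3)^(1-1/α) with hD
  have hD0 : 0 ≤ D := by positivity
  refine ⟨γ, 6*K*D, hγ0, hγ1, by positivity, fun β hβ k l hl f g hf hg hfg => ?_⟩
  obtain ⟨N, p, hp, hp1, hcone⟩ := exists_cells hα hβ l k
  set M := mInt f with hM
  have hM0 : 0 ≤ M := mInt_nonneg hf.cone.nonneg
  set r : ℝ := D * (l:ℝ)^(1-1/α) with hr
  have hr0 : 0 ≤ r := by positivity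
  have ha1 : (p 1)^(1-α) ≤ r := hp1 ▸ leftEnd_rpow_le hα hα1 hβ k hl
  have ha2 : (leftEnd β (k+l) l)^(1-α) ≤ r := leftEnd_rpow_le hα hα1 hβ (k+l) hl
  have ha2m := leftEnd_mem hβ (k+l) l
  have hKr : 0 ≤ K * r * M := by positivity
  have hrem : ∀ u, IsTame α u → mInt u = M →
      L1norm (fun x => u x - stepAvg N p u x) ≤ K * r * M := by
    intro u hu huM
    have h := hp.L1norm_sub_stepAvg_le hα hα1 hu
    rw [huM] at h
    exact h.trans (by gcongr)
  have htail : ∀ u, IsTame α u → mInt u = M →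
      ∫ x in Ioc 0 (leftEnd β (k+l) l), PopCompFrom β k l (stepAvg N p u) x ≤ 2*(K*r*M) := by
    intro u hu huM
    have h := hu.integral_PopCompFrom_stepAvg_le hβ hp hα hα1 k l ha2m
    rw [huM, show 3/(1-α)^2 = K/3 by rw [hK]; ring] at h
    have h1 : K/3 * (leftEnd β (k+l) l)^(1-α) * M ≤ K/3 * r * M := by gcongr
    have h2 : K * (p 1)^(1-α) * M ≤ K * r * M := by gcongr
    linarith
  set c : ℕ → ℝ := fun i => cellAvg p f i - cellAvg p g i with hc
  set F := PopCompFrom β k l (stepFun N p fun i => max (c i) 0) with hF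
  set G := PopCompFrom β k l (stepFun N p fun i => max (-c i) 0) with hG
  have hFc : IsCone α F := isCone_PopCompFrom_stepFun hα hcone fun i => le_max_right _ _
  have hGc : IsCone α G := isCone_PopCompFrom_stepFun hα hcone fun i => le_max_right _ _
  have hFi : IntegrableOn F (Ioc 0 1) :=
    integrableOn_PopCompFrom hβ k l (integrableOn_stepFun N p _)
  have hGi : IntegrableOn G (Ioc 0 1) :=
    integrableOn_PopCompFrom hβ k l (integrableOn_stepFun N p _)
  have hsub : (fun x => F x - G x)
      = PopCompFrom β k l fun x => stepAvg N p f x - stepAvg N p g x := by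
    rw [hF, hG, ← PopCompFrom_sub]
    congr 1
    funext x
    simp only [stepAvg, stepFun, ← Finset.sum_sub_distrib, ← sub_mul]
    refine Finset.sum_congr rfl fun i _ => ?_
    congr 1
    rcases le_total (c i) 0 with h | h
    · rw [max_eq_right h, max_eq_left (by linarith)]; simp [hc]
    · rw [max_eq_left h, max_eq_right (by linarith)]; simp [hc]
  have hmeans : mInt F = mInt G := by
    have h : mInt (fun x => F x - G x) = mInt F - mInt G := integral_sub hFi hGi
    have h' : mInt (fun x => stepAvg N p f x - stepAvg N p g x)
        = mInt (stepAvg N p f) - mInt (stepAvg N p g) :=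
      integral_sub (integrableOn_stepFun N p _) (integrableOn_stepFun N p _)
    have h'' : mInt (PopCompFrom β k l fun x => stepAvg N p f x - stepAvg N p g x)
        = mInt (fun x => stepAvg N p f x - stepAvg N p g x) :=
      mInt_PopCompFrom hβ k l ((integrableOn_stepFun N p _).sub (integrableOn_stepFun N p _))
    rw [hsub, h'', h',
      hp.mInt_stepAvg hf.integrable, hp.mInt_stepAvg hg.integrable] at h
    linarith
  have hsum : mInt F + mInt G ≤ L1norm (fun x => f x - g x) := by
    rw [hF, hG, mInt_PopCompFrom hβ k l (integrableOn_stepFun N p _),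
      mInt_PopCompFrom hβ k l (integrableOn_stepFun N p _), hp.mInt_stepFun, hp.mInt_stepFun,
      ← Finset.sum_add_distrib]
    refine le_trans (Finset.sum_le_sum fun i _ => ?_)
      (hp.sum_abs_cellAvg_sub_le hf.integrable hg.integrable)
    rw [← add_mul]
    refine le_of_eq ?_
    congr 1
    rcases le_total (c i) 0 with h | h
    · rw [max_eq_right h, max_eq_left (by linarith), zero_add]; exact (abs_of_nonpos h).symm
    · rw [max_eq_left h, max_eq_right (by linarith), add_zero]; exact (abs_of_nonneg h).symm
  have hs2 : Ioc 0 (leftEnd β (k+l) l) ⊆ Ioc (0:ℝ) 1 := Ioc_subset_Ioc_right ha2m.2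
  have hFt : ∫ x in Ioc 0 (leftEnd β (k+l) l), F x ≤ 2*(K*r*M) := by
    refine le_trans (setIntegral_mono_on (hFi.mono_set hs2) ((integrableOn_PopCompFrom hβ k l
      (integrableOn_stepFun N p _)).mono_set hs2) measurableSet_Ioc fun x hx =>
      PopCompFrom_le hβ k l (fun y _ => stepFun_le (fun i hi => ?_) y) x (hs2 hx)) (htail f hf rfl)
    have := hp.cellAvg_nonneg hg hi
    exact max_le (by simp only [hc]; linarith) (hp.cellAvg_nonneg hf hi)
  have hGt : ∫ x in Ioc 0 (leftEnd β (k+l) l), G x ≤ 2*(K*r*M) := by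
    refine le_trans (setIntegral_mono_on (hGi.mono_set hs2) ((integrableOn_PopCompFrom hβ k l
      (integrableOn_stepFun N p _)).mono_set hs2) measurableSet_Ioc fun x hx =>
      PopCompFrom_le hβ k l (fun y _ => stepFun_le (fun i hi => ?_) y) x (hs2 hx))
      (htail g hg hfg.symm)
    have := hp.cellAvg_nonneg hf hi
    exact max_le (by simp only [hc]; linarith) (hp.cellAvg_nonneg hg hi)
  have hFm : ∀ x ∈ Ioc (0:ℝ) 1, γ * (mInt F - 2*(K*r*M)) ≤ PopCompFrom β (k+l) l F x :=
    fun x hx => le_trans (by gcongr) (hmin β hβ l (k+l) F hFc hFi x hx)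
  have hGm : ∀ x ∈ Ioc (0:ℝ) 1, γ * (mInt F - 2*(K*r*M)) ≤ PopCompFrom β (k+l) l G x :=
    fun x hx => le_trans (by rw [hmeans]; gcongr) (hmin β hβ l (k+l) G hGc hGi x hx)
  have hmain := L1norm_le_of_le (integrableOn_PopCompFrom hβ (k+l) l hFi)
    (integrableOn_PopCompFrom hβ (k+l) l hGi) hFm hGm
  rw [mInt_PopCompFrom hβ _ _ hFi, mInt_PopCompFrom hβ _ _ hGi, ← PopCompFrom_sub, hsub,
    ← PopCompFrom_add_steps] at hmain
  have hfi := hf.integrable.sub (integrableOn_stepFun N p (cellAvg p f))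
  have hgi := hg.integrable.sub (integrableOn_stepFun N p (cellAvg p g))
  have hdec : (fun x => f x - g x) = fun x => (stepAvg N p f x - stepAvg N p g x)
      + ((f x - stepAvg N p f x) - (g x - stepAvg N p g x)) := by funext x; ring
  have hR := (L1norm_PopCompFrom_le hβ k (l+l) (hfi.sub hgi)).trans (L1norm_sub_le hfi hgi)
  have h1 := hrem f hf rfl
  have h2 := hrem g hg hfg.symm
  have hstep := L1norm_add_le
    (integrableOn_PopCompFrom hβ k (l+l) ((integrableOn_stepFun N p (cellAvg p f)).sub
      (integrableOn_stepFun N p (cellAvg p g))))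
    (integrableOn_PopCompFrom hβ k (l+l) (hfi.sub hgi))
  have hlhs : L1norm (PopCompFrom β k (l+l) fun x => f x - g x) ≤
      L1norm (PopCompFrom β k (l+l) fun x => stepAvg N p f x - stepAvg N p g x)
      + 2 * (K*r*M) := by
    conv_lhs => rw [hdec, PopCompFrom_add]
    refine hstep.trans (add_le_add le_rfl (hR.trans ?_))
    have h1' : L1norm (f - stepFun N p (cellAvg p f)) ≤ K*r*M := h1
    have h2' : L1norm (g - stepFun N p (cellAvg p g)) ≤ K*r*M := h2
    exact (add_le_add h1' h2').trans_eq (by ring)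
  have hγM : γ * (K*r*M) ≤ K*r*M := mul_le_of_le_one_left hKr hγ1
  have hγs := mul_le_mul_of_nonneg_left hsum (sub_nonneg.2 hγ1)
  rw [← hmeans] at hmain hγs
  have e : 6*K*D * (l:ℝ)^(1-1/α) * M = 6 * (K*r*M) := by rw [hr]; ring
  rw [e]
  linarith

lemma L1norm_PopCompFrom_iterate_le {α γ E : ℝ} {β : ℕ → ℝ} {l : ℕ} {f g : ℝ → ℝ}
    (hα : 0 < α) (hα1 : α < 1) (hγ0 : 0 < γ) (hγ1 : γ ≤ 1) (hβ : ∀ i, β i ∈ Ioc (0:ℝ) α)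
    (hf : IsTame α f) (hg : IsTame α g) (hfg : mInt f = mInt g)
    (hblock : ∀ k : ℕ, ∀ u v : ℝ → ℝ, IsTame α u → IsTame α v → mInt u = mInt v →
      L1norm (PopCompFrom β k (l+l) fun x => u x - v x)
        ≤ (1-γ) * L1norm (fun x => u x - v x) + E * mInt u) (j : ℕ) :
    L1norm (PopCompFrom β 0 (j*(l+l)) fun x => f x - g x)
      ≤ (1-γ)^j * L1norm (fun x => f x - g x) + E/γ * mInt f := by
  induction j with
  | zero =>
    have hE : 0 ≤ E/γ * mInt f := by
      have h := hblock 0 f f hf hf rfl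
      have e : (fun x => f x - f x) = fun _ => (0:ℝ) * 0 := by funext x; simp
      rw [e, PopCompFrom_const_mul] at h
      simp only [L1norm, zero_mul, abs_zero, integral_zero, mul_zero, zero_add] at h
      rw [div_mul_eq_mul_div]
      exact div_nonneg h hγ0.le
    simp only [zero_mul, pow_zero, one_mul, PopCompFrom]
    linarith
  | succ j ih =>
    have h := hblock (0 + j*(l+l)) _ _ (hf.PopCompFrom hβ hα hα1 0 (j*(l+l)))
      (hg.PopCompFrom hβ hα hα1 0 (j*(l+l)))
      (by rw [mInt_PopCompFrom hβ _ _ hf.integrable, mInt_PopCompFrom hβ _ _ hg.integrable, hfg])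
    rw [← PopCompFrom_sub, ← PopCompFrom_add_steps, mInt_PopCompFrom hβ _ _ hf.integrable] at h
    rw [add_mul, one_mul]
    refine h.trans ?_
    have h2 := mul_le_mul_of_nonneg_left ih (sub_nonneg.2 hγ1)
    have e : γ * (E/γ * mInt f) = E * mInt f := by field_simp
    rw [pow_succ]
    linarith

/-- The optimal choice of the number `j` of blocks and of their length `l`. -/
lemma exists_block_parameters {γ C s : ℝ} (hγ0 : 0 < γ) (hγ1 : γ ≤ 1) (hC : 0 ≤ C) (hs : 0 < s) :
    ∃ A : ℝ, 0 ≤ A ∧ ∀ n : ℕ, 1 < n →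
      2 ≤ A * ((n:ℝ)^(-s) * Real.log n^(s+1)) ∨
      ∃ j l : ℕ, 0 < l ∧ j*(l+l) ≤ n ∧
        (1-γ)^j * 2 + C * (l:ℝ)^(-s) ≤ A * ((n:ℝ)^(-s) * Real.log n^(s+1)) := by
  have hl2 : 0 < Real.log 2 := Real.log_pos (by norm_num)
  set B : ℝ := s/γ + 1/Real.log 2 with hB
  have hB0 : 0 < B := by positivity
  set c₁ : ℝ := (Real.log 2^(s+1))⁻¹ with hc₁
  set c₂ : ℝ := (4*B)^s / Real.log 2 with hc₂
  refine ⟨2*c₁ + (C+2)*c₂, by positivity, fun n hn => ?_⟩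
  have hn2 : (2:ℝ) ≤ n := by exact_mod_cast hn
  have hn0 : (0:ℝ) < n := by linarith
  set L := Real.log n with hL
  have hlL : Real.log 2 ≤ L := Real.log_le_log (by norm_num) hn2
  have hL0 : 0 < L := hl2.trans_le hlL
  set Q : ℝ := (n:ℝ)^(-s) * L^(s+1) with hQ
  have hQ0 : 0 ≤ Q := by positivity
  have hns : (n:ℝ)^(-s) ≤ c₁ * Q := by
    have h : Real.log 2^(s+1) ≤ L^(s+1) := Real.rpow_le_rpow hl2.le hlL (by linarith)
    rw [hc₁, ← div_eq_inv_mul, le_div_iff₀ (by positivity)]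
    exact mul_le_mul_of_nonneg_left h (by positivity)
  set j := ⌈s/γ * L⌉₊ with hj
  have hj0 : 0 < j := Nat.ceil_pos.2 (by positivity)
  have hj0' : (0:ℝ) < j := by exact_mod_cast hj0
  have hjB : (j:ℝ) ≤ B * L := by
    have h1 := (Nat.ceil_lt_add_one (a := s/γ * L) (by positivity)).le
    have h2 : 1 ≤ 1/Real.log 2 * L := by rwa [one_div_mul_eq_div, one_le_div hl2]
    rw [hB, add_mul]
    linarith
  have hjs : (4*j/n)^s ≤ c₂ * Q := by
    calc (4*j/n : ℝ)^s ≤ (4*(B*L)/n)^s := by gcongr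
      _ = (4*B)^s * (L^s * (n:ℝ)^(-s)) := by
        rw [Real.rpow_neg hn0.le, ← Real.inv_rpow hn0.le, ← Real.mul_rpow hL0.le (by positivity),
          ← Real.mul_rpow (by positivity) (by positivity)]
        congr 1
        field_simp
      _ ≤ (4*B)^s * ((L^s * L / Real.log 2) * (n:ℝ)^(-s)) := by
        gcongr
        rw [le_div_iff₀ hl2]
        gcongr
      _ = c₂ * Q := by rw [hQ, hc₂, Real.rpow_add_one hL0.ne']; ring
  rcases lt_or_ge n (2*j) with h | h
  · left
    have h' : (n:ℝ) ≤ 2*j := by exact_mod_cast h.le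
    have h1 : (1:ℝ) ≤ (4*j/n)^s := by
      refine Real.one_le_rpow ?_ hs.le
      rw [one_le_div hn0]
      linarith
    have : 0 ≤ c₁ * Q := by positivity
    have : 0 ≤ C * (c₂ * Q) := by positivity
    linarith
  · right
    have hl0 : 0 < n/(2*j) := Nat.div_pos h (by omega)
    refine ⟨j, n/(2*j), hl0, ?_, ?_⟩
    · have := Nat.mul_div_le n (2*j)
      linarith
    · set l := n/(2*j) with hl
      have hl1 : (1:ℝ) ≤ l := by exact_mod_cast hl0
      have hnl : (n:ℝ) ≤ 4*j*l := by
        have h1 : n < 2*j*(l+1) := Nat.lt_mul_div_succ n (by omega)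
        have h2 : (n:ℝ) < 2*j*(l+1) := by exact_mod_cast h1
        nlinarith
      have hls : (l:ℝ)^(-s) ≤ c₂ * Q := by
        refine le_trans ?_ hjs
        rw [Real.rpow_neg (by linarith), ← Real.inv_rpow (by linarith)]
        gcongr
        rw [inv_le_iff_one_le_mul₀ (by linarith), div_mul_eq_mul_div, one_le_div hn0]
        exact hnl
      have hpow : (1-γ)^j ≤ c₁ * Q := by
        refine le_trans ?_ hns
        calc (1-γ)^j ≤ Real.exp (-γ)^j :=
              pow_le_pow_left₀ (by linarith) (by linarith [Real.add_one_le_exp (-γ)]) j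
          _ = Real.exp (j * (-γ)) := (Real.exp_nat_mul _ _).symm
          _ ≤ Real.exp (L * (-s)) := by
              have h1 : s/γ * L ≤ j := Nat.le_ceil _
              have h2 : s/γ * L * γ = L * s := by field_simp
              have h3 := mul_le_mul_of_nonneg_right h1 hγ0.le
              exact Real.exp_le_exp.2 (by linarith)
          _ = (n:ℝ)^(-s) := (Real.rpow_def_of_pos hn0 _).symm
      have : C * (l:ℝ)^(-s) ≤ C * (c₂ * Q) := by gcongr
      have : 0 ≤ c₂ * Q := by positivity
      linarith

/-- Loss of memory for tame functions. -/
theorem exists_loss_of_memory_tame {α : ℝ} (hα : 0 < α) (hα1 : α < 1) :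
    ∃ A : ℝ, 0 ≤ A ∧ ∀ β : ℕ → ℝ, (∀ i, β i ∈ Ioc (0:ℝ) α) → ∀ f g : ℝ → ℝ, IsTame α f →
      IsTame α g → mInt f = mInt g → ∀ n : ℕ, 1 < n →
        L1norm (PopCompFrom β 0 n fun x => f x - g x)
          ≤ A * ((n:ℝ)^(1-1/α) * Real.log n^(1/α)) * mInt f := by
  obtain ⟨γ, C, hγ0, hγ1, hC, hblock⟩ := exists_block_contraction hα hα1
  have hs : 0 < 1/α - 1 := by rw [sub_pos, lt_div_iff₀ hα]; linarith
  obtain ⟨A, hA, hpar⟩ := exists_block_parameters hγ0 hγ1 (div_nonneg hC hγ0.le) hs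
  refine ⟨A, hA, fun β hβ f g hf hg hfg n hn => ?_⟩
  have hM := mInt_nonneg hf.cone.nonneg
  have habs : ∀ u, IsTame α u → L1norm u = mInt u := fun u hu =>
    setIntegral_congr_fun measurableSet_Ioc fun x hx => abs_of_nonneg (hu.cone.nonneg x hx)
  have h2M : L1norm (fun x => f x - g x) ≤ 2 * mInt f := by
    have h := L1norm_sub_le hf.integrable hg.integrable
    rw [habs f hf, habs g hg, ← hfg] at h
    linarith
  have hint := hf.integrable.sub hg.integrable
  have h := hpar n hn
  rw [neg_sub, sub_add_cancel] at h
  rcases h with h | ⟨j, l, hl, hjl, h⟩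
  · exact (L1norm_PopCompFrom_le hβ 0 n hint).trans (h2M.trans (by gcongr))
  · obtain ⟨m, rfl⟩ := Nat.exists_eq_add_of_le hjl
    have hit := L1norm_PopCompFrom_iterate_le hα hα1 hγ0 hγ1 hβ hf hg hfg
      (fun k u v => hblock β hβ k l hl u v) j
    rw [PopCompFrom_add_steps]
    refine (L1norm_PopCompFrom_le hβ _ m (integrableOn_PopCompFrom hβ _ _ hint)).trans
      (hit.trans ?_)
    have h1 : (1-γ)^j * L1norm (fun x => f x - g x) ≤ (1-γ)^j * (2 * mInt f) := by
      have := pow_nonneg (sub_nonneg.2 hγ1) j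
      gcongr
    have h3 := mul_le_mul_of_nonneg_right h hM
    have e : C * (l:ℝ)^(1-1/α) / γ = C/γ * (l:ℝ)^(1-1/α) := by ring
    rw [e]
    linarith

lemma abs_le_C1norm {φ : ℝ → ℝ} (hφ : ContDiff ℝ 1 φ) {x : ℝ} (hx : x ∈ Icc (0:ℝ) 1) :
    |φ x| + |deriv φ x| ≤ C1norm φ := by
  have h : ∀ f : ℝ → ℝ, Continuous f → |f x| ≤ ⨆ y : Icc (0:ℝ) 1, |f (y:ℝ)| := fun f hf => by
    have hb : BddAbove (range fun y : Icc (0:ℝ) 1 => |f (y:ℝ)|) :=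
      (isCompact_range (hf.abs.comp continuous_subtype_val)).bddAbove
    exact le_ciSup hb ⟨x, hx⟩
  exact add_le_add (h φ hφ.continuous) (h _ (hφ.continuous_deriv le_rfl))

/-- A `C¹` function becomes tame after adding an affine function. -/
lemma IsTame.of_contDiff {α N : ℝ} {φ : ℝ → ℝ} (hα : 0 < α) (hα1 : α < 1) (hφ : ContDiff ℝ 1 φ)
    (hN : ∀ x ∈ Icc (0:ℝ) 1, |φ x| ≤ N ∧ |deriv φ x| ≤ N) :
    IsTame α (fun x => φ x - (N * x - 4 * N)) := by
  have hN0 : 0 ≤ N := (abs_nonneg _).trans (hN 0 (by simp)).1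
  have hd : ∀ x, HasDerivAt φ (deriv φ x) x := fun x =>
    (hφ.differentiable one_ne_zero x).hasDerivAt
  have hu : ∀ x, HasDerivAt (fun x => φ x - (N * x - 4 * N)) (deriv φ x - N) x := fun x => by
    have h := (hd x).fun_sub (((hasDerivAt_id' x).const_mul N).sub_const (4*N))
    rwa [mul_one] at h
  have hv : ∀ x, HasDerivAt (fun x => x * (φ x - (N * x - 4 * N)))
      (φ x - (N * x - 4 * N) + x * (deriv φ x - N)) x := fun x => by
    have h := (hasDerivAt_id' x).fun_mul (hu x)
    rwa [one_mul] at h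
  have hlow : ∀ x ∈ Ioc (0:ℝ) 1, 2 * N ≤ φ x - (N * x - 4 * N) := fun x hx => by
    have h := abs_le.1 (hN x (Ioc_subset_Icc_self hx)).1
    nlinarith [hx.1, hx.2]
  have hanti : AntitoneOn (fun x => φ x - (N * x - 4 * N)) (Icc 0 1) := by
    refine antitoneOn_of_deriv_nonpos (convex_Icc 0 1)
      (fun x _ => (hu x).continuousAt.continuousWithinAt)
      (fun x _ => (hu x).differentiableAt.differentiableWithinAt) fun x hx => ?_
    rw [(hu x).deriv]
    linarith [(abs_le.1 (hN x (interior_subset hx)).2).2]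
  have hmono : MonotoneOn (fun x => x * (φ x - (N * x - 4 * N))) (Icc 0 1) := by
    refine monotoneOn_of_deriv_nonneg (convex_Icc 0 1)
      (fun x _ => (hv x).continuousAt.continuousWithinAt)
      (fun x _ => (hv x).differentiableAt.differentiableWithinAt) fun x hx => ?_
    rw [(hv x).deriv]
    rw [interior_Icc] at hx
    have h := hlow x ⟨hx.1, hx.2.le⟩
    have h' := (abs_le.1 (hN x (Ioo_subset_Icc_self hx)).2).1
    nlinarith [hx.1, hx.2]
  have hint : IntegrableOn (fun x => φ x - (N * x - 4 * N)) (Ioc 0 1) := by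
    refine (Continuous.integrableOn_Icc ?_).mono_set Ioc_subset_Icc_self
    have := hφ.continuous
    fun_prop
  refine ⟨⟨fun x hx => le_trans (by linarith) (hlow x hx), hanti.mono Ioc_subset_Icc_self, ?_⟩,
    hint, fun x hx => ?_⟩
  · intro x hx y hy hxy
    have e : ∀ z : ℝ, 0 < z → z^(α+1) * (φ z - (N * z - 4 * N))
        = z^α * (z * (φ z - (N * z - 4 * N))) := fun z hz => by
      rw [Real.rpow_add_one hz.ne', mul_assoc]
    simp only [e x hx.1, e y hy.1]
    refine mul_le_mul (Real.rpow_le_rpow hx.1.le hxy hα.le)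
      (hmono (Ioc_subset_Icc_self hx) (Ioc_subset_Icc_self hy) hxy)
      (mul_nonneg hx.1.le (le_trans (by linarith) (hlow x hx))) (Real.rpow_nonneg hy.1.le _)
  · have hM : 2 * N ≤ mInt (fun x => φ x - (N * x - 4 * N)) := by
      calc 2 * N = ∫ _ in Ioc (0:ℝ) 1, 2 * N := by rw [setIntegral_const]; simp
        _ ≤ _ := setIntegral_mono_on (integrableOn_const (by simp)) hint measurableSet_Ioc hlow
    have h1 : (1:ℝ) ≤ x^(-α) := Real.one_le_rpow_of_pos_of_le_one_of_nonpos hx.1 hx.2 (by linarith)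
    have h3 : 3 ≤ 3/(1-α) := by rw [le_div_iff₀ (by linarith)]; linarith
    have h := (abs_le.1 (hN x (Ioc_subset_Icc_self hx)).1).2
    have hx0 := mul_nonneg hN0 hx.1.le
    calc φ x - (N * x - 4 * N) ≤ 3 * 1 * (2 * N) := by linarith
      _ ≤ _ := by gcongr

lemma PopCompFrom_congr_seq {β β' : ℕ → ℝ} {k n : ℕ} (h : ∀ i, k < i → i ≤ k + n → β i = β' i)
    (f : ℝ → ℝ) : PopCompFrom β k n f = PopCompFrom β' k n f := by
  induction n with
  | zero => rfl
  | succ n ih =>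
    rw [PopCompFrom, PopCompFrom, ih fun i h1 h2 => h i h1 (by omega),
      h (k + n + 1) (by omega) le_rfl]

/-- Main theorem, `C¹` observables: there exist a constant `C_α > 0` and
an affine function `F(t) = p t + q` such that for all `φ, ψ ∈ C¹(S¹)` with equal means,
every `n > 1` and every sequence `β₁, …, β_n ∈ (0,α]`,
`∫ |P_{β_n} ∘ ⋯ ∘ P_{β_1} φ - P_{β_n} ∘ ⋯ ∘ P_{β_1} ψ| dm
  ≤ C_α F(‖φ‖_{C¹} + ‖ψ‖_{C¹}) n^(1-1/α) (log n)^(1/α)`. -/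
theorem polynomial_loss_of_memory_C1 (α : ℝ) (hα0 : 0 < α) (hα1 : α < 1) :
    ∃ C > 0, ∃ p q : ℝ, ∀ φ ψ : ℝ → ℝ,
      ContDiff ℝ 1 φ → Function.Periodic φ 1 →
      ContDiff ℝ 1 ψ → Function.Periodic ψ 1 →
      mInt φ = mInt ψ →
      ∀ n : ℕ, 1 < n → ∀ β : ℕ → ℝ, (∀ i, 1 ≤ i → i ≤ n → β i ∈ Set.Ioc (0:ℝ) α) →
      (∫ x in Set.Ioc (0:ℝ) 1, |PopComp β n φ x - PopComp β n ψ x|)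
        ≤ C * (p * (C1norm φ + C1norm ψ) + q) * (n:ℝ)^(1-1/α) * (Real.log n)^(1/α) := by
  obtain ⟨A, hA, h⟩ := exists_loss_of_memory_tame hα0 hα1
  refine ⟨A + 1, by linarith, 5, 0, fun φ ψ hφ _ hψ _ hφψ n hn β hβ => ?_⟩
  set N := C1norm φ + C1norm ψ with hN
  have hφN : ∀ x ∈ Icc (0:ℝ) 1, |φ x| + |deriv φ x| ≤ C1norm φ := fun x hx => abs_le_C1norm hφ hx
  have hψN : ∀ x ∈ Icc (0:ℝ) 1, |ψ x| + |deriv ψ x| ≤ C1norm ψ := fun x hx => abs_le_C1norm hψ hx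
  have hbφ : ∀ x ∈ Icc (0:ℝ) 1, |φ x| ≤ N ∧ |deriv φ x| ≤ N := fun x hx => by
    have h1 := hφN x hx
    have h2 := hψN x hx
    constructor <;> linarith [abs_nonneg (φ x), abs_nonneg (deriv φ x), abs_nonneg (ψ x),
      abs_nonneg (deriv ψ x)]
  have hbψ : ∀ x ∈ Icc (0:ℝ) 1, |ψ x| ≤ N ∧ |deriv ψ x| ≤ N := fun x hx => by
    have h1 := hφN x hx
    have h2 := hψN x hx
    constructor <;> linarith [abs_nonneg (φ x), abs_nonneg (deriv φ x), abs_nonneg (ψ x),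
      abs_nonneg (deriv ψ x)]
  have hN0 : 0 ≤ N := (abs_nonneg _).trans (hbφ 0 (by simp)).1
  have hf := IsTame.of_contDiff hα0 hα1 hφ hbφ
  have hg := IsTame.of_contDiff hα0 hα1 hψ hbψ
  have hmean : ∀ u : ℝ → ℝ, Continuous u → mInt (fun x => u x - (N * x - 4 * N))
      = mInt u - ∫ x in Ioc (0:ℝ) 1, (N * x - 4 * N) := fun u hu =>
    integral_sub (hu.integrableOn_Icc.mono_set Ioc_subset_Icc_self)
      ((show Continuous fun x : ℝ => N * x - 4 * N by fun_prop).integrableOn_Icc.mono_set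
        Ioc_subset_Icc_self)
  have hfg : mInt (fun x => φ x - (N * x - 4 * N)) = mInt (fun x => ψ x - (N * x - 4 * N)) := by
    rw [hmean φ hφ.continuous, hmean ψ hψ.continuous, hφψ]
  have hM : mInt (fun x => φ x - (N * x - 4 * N)) ≤ 5 * N := by
    calc _ ≤ ∫ _ in Ioc (0:ℝ) 1, 5 * N :=
          setIntegral_mono_on hf.integrable (integrableOn_const (by simp)) measurableSet_Ioc
            fun x hx => by
              have h1 := (abs_le.1 (hbφ x (Ioc_subset_Icc_self hx)).1).2
              have h2 := mul_nonneg hN0 hx.1.le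
              linarith
      _ = 5 * N := by rw [setIntegral_const]; simp
  set β' : ℕ → ℝ := fun i => if 1 ≤ i ∧ i ≤ n then β i else α with hβ'
  have hβ'm : ∀ i, β' i ∈ Ioc (0:ℝ) α := fun i => by
    by_cases hi : 1 ≤ i ∧ i ≤ n
    · simpa [hβ', hi] using hβ i hi.1 hi.2
    · simp [hβ', hi, hα0]
  have hcongr : ∀ f : ℝ → ℝ, PopComp β n f = PopCompFrom β' 0 n f := fun f =>
    PopCompFrom_congr_seq (fun i h1 h2 => by
      rw [zero_add] at h2
      simp [hβ', h2, Nat.one_le_iff_ne_zero.2 (Nat.pos_iff_ne_zero.1 h1)]) f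
  have hmain := h β' hβ'm _ _ hf hg hfg n hn
  simp only [sub_sub_sub_cancel_right] at hmain
  rw [PopCompFrom_sub] at hmain
  rw [hcongr, hcongr]
  refine hmain.trans ?_
  have hQ : 0 ≤ (n:ℝ)^(1-1/α) * Real.log n^(1/α) :=
    mul_nonneg (by positivity) (Real.rpow_nonneg (Real.log_natCast_nonneg n) _)
  calc _ ≤ A * ((n:ℝ)^(1-1/α) * Real.log n^(1/α)) * (5 * N) := by gcongr
    _ ≤ (A + 1) * ((n:ℝ)^(1-1/α) * Real.log n^(1/α)) * (5 * N) := by gcongr; linarith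
    _ = _ := by ring
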